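/- Let N ≥ 3, let α, β > -N, let p, q > 1, and assume (N+α)/(p+1) + (N+β)/(q+1) ≤ N - 2. Then there is no pair (u, v) of functions, each continuous on the closed unit ball B̄ ⊂ ℝ^N and twice continuously differentiable on B̄ ∖ {0}, with u > 0 and v > 0 on B ∖ {0}, u = v = 0 on ∂B, satisfying -Δv(x) = |x|^α u(x)^p and -Δu(x) = |x|^β v(x)^q for all x ∈ B ∖ {0}, and such that the integrals ∫_B |x|^α u^{p+1} dx, ∫_B |x|^β v^{q+1} dx and ∫_B |∇u(x)| |∇v(x)| dx are all finite. -/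

import Mathlib

open MeasureTheory Metric Set Filter

noncomputable section

abbrev E (N : ℕ) := EuclideanSpace ℝ (Fin N)

/-- The Laplacian: sum of pure second partial derivatives. -/
def lap {N : ℕ} (u : E N → ℝ) (x : E N) : ℝ :=
  ∑ i, fderiv ℝ (fun y => fderiv ℝ u y (EuclideanSpace.single i 1)) x (EuclideanSpace.single i 1)

namespace CR

open Topology

/-! ### One-dimensional cutoff functions -/

def tb (s : ℝ) : ℝ := max 0 (s * (1 - s))

def tT (s : ℝ) : ℝ := ∫ t in (0:ℝ)..s, tb t

lemma tb_cont : Continuous tb := by unfold tb; fun_prop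

lemma tb_nonneg (s : ℝ) : 0 ≤ tb s := le_max_left _ _

lemma tb_le_one (s : ℝ) : tb s ≤ 1 := by
  unfold tb
  exact max_le zero_le_one (by nlinarith [sq_nonneg (s - 1/2)])

lemma tb_zero_left {s : ℝ} (h : s ≤ 0) : tb s = 0 := by
  unfold tb
  exact max_eq_left (by nlinarith)

lemma tb_zero_right {s : ℝ} (h : 1 ≤ s) : tb s = 0 := by
  unfold tb
  exact max_eq_left (by nlinarith)

lemma tb_pos {s : ℝ} (h : 0 < s) (h1 : s < 1) : 0 < tb s := by
  unfold tb
  exact lt_max_of_lt_right (by nlinarith)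

lemma tT_hasDerivAt (s : ℝ) : HasDerivAt tT (tb s) s :=
  (tb_cont.integral_hasStrictDerivAt 0 s).hasDerivAt

lemma tT_cont : Continuous tT :=
  continuous_iff_continuousAt.2 fun s => (tT_hasDerivAt s).continuousAt

lemma tT_mono : Monotone tT := by
  apply monotone_of_deriv_nonneg (fun s => (tT_hasDerivAt s).differentiableAt)
  intro s
  rw [(tT_hasDerivAt s).deriv]
  exact tb_nonneg s

lemma tT_zero {s : ℝ} (h : s ≤ 0) : tT s = 0 := by
  unfold tT
  rw [intervalIntegral.integral_congr (g := fun _ => (0:ℝ))]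
  · simp
  · intro t ht
    rw [uIcc_of_ge h] at ht
    exact tb_zero_left ht.2

lemma tT_const {s : ℝ} (h : 1 ≤ s) : tT s = tT 1 := by
  unfold tT
  rw [← intervalIntegral.integral_add_adjacent_intervals (b := 1)
    (tb_cont.intervalIntegrable _ _) (tb_cont.intervalIntegrable _ _)]
  rw [intervalIntegral.integral_congr (a := 1) (b := s) (g := fun _ => (0:ℝ))]
  · simp
  · intro t ht
    rw [uIcc_of_le h] at ht
    exact tb_zero_right ht.1

lemma tT_nonneg (s : ℝ) : 0 ≤ tT s := by
  rcases le_total s 0 with h | h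
  · rw [tT_zero h]
  · have := tT_mono h
    rwa [tT_zero le_rfl] at this

lemma tT_le (s : ℝ) : tT s ≤ tT 1 := by
  rcases le_total s 1 with h | h
  · exact tT_mono h
  · rw [tT_const h]

lemma tT_one_pos : 0 < tT 1 := by
  unfold tT
  apply intervalIntegral.intervalIntegral_pos_of_pos_on (tb_cont.intervalIntegrable _ _)
  · intro x hx
    exact tb_pos hx.1 hx.2
  · norm_num

lemma tT_one_le : tT 1 ≤ 1 := by
  have : tT 1 ≤ ∫ t in (0:ℝ)..1, (1:ℝ) := by
    apply intervalIntegral.integral_mono_on (by norm_num) (tb_cont.intervalIntegrable _ _)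
    · simp
    · intro x _
      exact tb_le_one x
  simpa using this

lemma tT_le_one (s : ℝ) : tT s ≤ 1 := (tT_le s).trans tT_one_le

def gc (δ ε s : ℝ) : ℝ := tT ((1 - δ - s) / δ) * tT (s / ε - 1)

def gd (δ ε s : ℝ) : ℝ :=
  (-(tb ((1 - δ - s) / δ) / δ)) * tT (s / ε - 1) + tT ((1 - δ - s) / δ) * (tb (s / ε - 1) / ε)

lemma gc_hasDerivAt (δ ε s : ℝ) : HasDerivAt (gc δ ε) (gd δ ε s) s := by
  have h1 : HasDerivAt (fun s : ℝ => (1 - δ - s) / δ) (-1 / δ) s := by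
    have := ((hasDerivAt_id s).const_sub (1 - δ)).div_const δ
    simpa using this
  have h2 : HasDerivAt (fun s : ℝ => s / ε - 1) (1 / ε) s := by
    have := ((hasDerivAt_id s).div_const ε).sub_const 1
    simpa using this
  have h3 := (tT_hasDerivAt ((1 - δ - s) / δ)).comp s h1
  have h4 := (tT_hasDerivAt (s / ε - 1)).comp s h2
  have h5 := h3.mul h4
  refine HasDerivAt.congr_deriv (f := gc δ ε) h5 ?_
  unfold gd
  simp only [Function.comp]
  ring

lemma gc_cont (δ ε : ℝ) : Continuous (gc δ ε) := by
  have := tT_cont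
  unfold gc
  fun_prop

lemma gd_cont (δ ε : ℝ) : Continuous (gd δ ε) := by
  have := tT_cont
  have := tb_cont
  unfold gd
  fun_prop

lemma gc_supp {δ ε : ℝ} (hδ : 0 < δ) (hε : 0 < ε) (s : ℝ) (hs : s ∉ Icc ε (1 - δ)) :
    gc δ ε s = 0 := by
  unfold gc
  by_cases h : s < ε
  · rw [tT_zero (s := s / ε - 1), mul_zero]
    rw [sub_nonpos, div_le_one hε]; exact h.le
  · rw [tT_zero (s := (1 - δ - s) / δ), zero_mul]
    have : 1 - δ < s := by
      by_contra h2
      exact hs ⟨not_lt.1 h, not_lt.1 h2⟩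
    exact div_nonpos_of_nonpos_of_nonneg (by linarith) hδ.le

lemma gd_supp {δ ε : ℝ} (hδ : 0 < δ) (hε : 0 < ε) (s : ℝ) (hs : s ∉ Icc ε (1 - δ)) :
    gd δ ε s = 0 := by
  unfold gd
  by_cases h : s < ε
  · have : s / ε - 1 ≤ 0 := by
      rw [sub_nonpos, div_le_one hε]; exact h.le
    rw [tT_zero this, tb_zero_left this]
    simp
  · have : 1 - δ < s := by
      by_contra h2
      exact hs ⟨not_lt.1 h, not_lt.1 h2⟩
    have : (1 - δ - s) / δ ≤ 0 := div_nonpos_of_nonpos_of_nonneg (by linarith) hδ.le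
    rw [tT_zero this, tb_zero_left this]
    simp

lemma gc_nonneg (δ ε s : ℝ) : 0 ≤ gc δ ε s := mul_nonneg (tT_nonneg _) (tT_nonneg _)

lemma gc_plateau {δ ε : ℝ} (hδ : 0 < δ) (hε : 0 < ε) {s : ℝ} (h1 : 2 * ε ≤ s) (h2 : s ≤ 1 - 2 * δ) :
    gc δ ε s = tT 1 * tT 1 := by
  unfold gc
  rw [tT_const (s := (1 - δ - s) / δ), tT_const (s := s / ε - 1)]
  · have : 2 ≤ s / ε := by rw [le_div_iff₀ hε]; exact h1
    linarith
  · rw [le_div_iff₀ hδ]; linarith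

lemma gd_bound {δ ε : ℝ} (hδ : 0 < δ) (hε : 0 < ε) {s : ℝ} (hs : 0 < s) :
    |gd δ ε s| ≤ (1 / δ + 2) / s := by
  by_cases hm : s ∈ Icc ε (1 - δ)
  swap
  · rw [gd_supp hδ hε s hm, abs_zero]; positivity
  unfold gd
  refine (abs_add_le _ _).trans ?_
  rw [add_div]
  apply add_le_add
  · rw [abs_mul, abs_neg, abs_of_nonneg (div_nonneg (tb_nonneg _) hδ.le),
      abs_of_nonneg (tT_nonneg _)]
    have h1 : tb ((1 - δ - s) / δ) / δ ≤ 1 / δ := by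
      gcongr; exact tb_le_one _
    have h2 : tb ((1 - δ - s) / δ) / δ * tT (s / ε - 1) ≤ 1 / δ * 1 := by
      apply mul_le_mul h1 (tT_le_one _) (tT_nonneg _) (by positivity)
    refine h2.trans ?_
    rw [mul_one, le_div_iff₀ hs]
    have : s ≤ 1 := by linarith [hm.2]
    have h0 : 0 < 1 / δ := by positivity
    nlinarith
  · rw [abs_mul, abs_of_nonneg (div_nonneg (tb_nonneg _) hε.le),
      abs_of_nonneg (tT_nonneg _)]
    have h3 : tb (s / ε - 1) / ε ≤ 2 / s := by
      by_cases h : s ≤ 2 * ε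
      · rw [div_le_div_iff₀ hε hs]
        have := tb_le_one (s / ε - 1)
        have := tb_nonneg (s / ε - 1)
        nlinarith
      · rw [tb_zero_right]
        · simp; positivity
        · have : 2 ≤ s / ε := by rw [le_div_iff₀ hε]; linarith
          linarith
    calc _ ≤ 1 * (2 / s) := mul_le_mul (tT_le_one _) h3 (div_nonneg (tb_nonneg _) hε.le) zero_le_one
      _ = _ := one_mul _

lemma gd_limit (δ : ℝ) {ε s : ℝ} (hε : 0 < ε) (h : 2 * ε ≤ s) :
    gd δ ε s = -(tb ((1 - δ - s) / δ) / δ) * tT 1 := by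
  have : 2 ≤ s / ε := by rw [le_div_iff₀ hε]; linarith
  have h1 : 1 ≤ s / ε - 1 := by linarith
  unfold gd
  rw [tb_zero_right h1, tT_const h1]
  simp

/-! ### Partial derivatives and integration by parts -/

variable {N : ℕ}

abbrev ee (i : Fin N) : E N := EuclideanSpace.single i (1:ℝ)

def pd (u : E N → ℝ) (i : Fin N) (x : E N) : ℝ := fderiv ℝ u x (ee i)

abbrev UU (N : ℕ) : Set (E N) := ball (0 : E N) 1 \ {0}

lemma UU_open : IsOpen (UU N) := isOpen_ball.sdiff isClosed_singleton

lemma mem_UU {x : E N} : x ∈ UU N ↔ ‖x‖ < 1 ∧ x ≠ 0 := by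
  simp [UU]

lemma mem_UU_of_sq {x : E N} {r R : ℝ} (hr : 0 < r) (hR : R < 1) (h : ‖x‖ ^ 2 ∈ Icc r R) :
    x ∈ UU N := by
  rw [mem_UU]
  constructor
  · have := h.2
    by_contra h1
    have h1 := not_lt.1 h1
    nlinarith
  · rintro rfl
    have := h.1
    simp at this
    linarith

lemma line_pd {f : E N → ℝ} {x : E N} (h : DifferentiableAt ℝ f x) (i : Fin N) :
    HasDerivAt (fun t : ℝ => f (x + t • ee i)) (pd f i x) 0 :=
  h.hasFDerivAt.hasLineDerivAt (ee i)

lemma line_normsq (x : E N) (i : Fin N) :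
    HasDerivAt (fun t : ℝ => ‖x + t • ee i‖ ^ 2) (2 * x i) 0 := by
  have h := ((hasStrictFDerivAt_norm_sq x).hasFDerivAt).hasLineDerivAt (ee i)
  have h' : HasDerivAt (fun t : ℝ => ‖x + t • ee i‖ ^ 2) _ 0 := h
  refine h'.congr_deriv ?_
  simp [ee, EuclideanSpace.inner_single_right]

lemma line_coord (x : E N) (i j : Fin N) :
    HasDerivAt (fun t : ℝ => (x + t • ee i) j) (if j = i then 1 else 0) 0 := by
  have : (fun t : ℝ => (x + t • ee i) j) = fun t => x j + t * (if j = i then 1 else 0) := by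
    funext t
    simp [ee]
  rw [this]
  simpa using ((hasDerivAt_id (0:ℝ)).mul_const (if j = i then (1:ℝ) else 0)).const_add (x j)

lemma integrable_rad {k : ℝ → ℝ} (hk : Continuous k) {r R : ℝ} (hr : 0 < r) (hR : R < 1)
    (hs : ∀ s, s ∉ Icc r R → k s = 0) {h : E N → ℝ} (hh : ContinuousOn h (UU N)) :
    Integrable (fun x : E N => k (‖x‖ ^ 2) * h x) := by
  let K : Set (E N) := (fun x : E N => ‖x‖ ^ 2) ⁻¹' Icc r R
  have hKc : IsClosed K := isClosed_Icc.preimage (by fun_prop)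
  have hKU : K ⊆ UU N := fun x hx => mem_UU_of_sq hr hR hx
  have hK : IsCompact K := by
    apply (isCompact_closedBall (0 : E N) 1).of_isClosed_subset hKc
    intro x hx
    have := (mem_UU.1 (hKU hx)).1
    simpa using this.le
  rw [← integrableOn_iff_integrable_of_support_subset (s := K)]
  · refine ContinuousOn.integrableOn_compact hK ?_
    apply ContinuousOn.mul
    · fun_prop
    · exact hh.mono hKU
  · intro x hx
    by_contra hc
    apply hx
    simp only
    rw [hs _ hc, zero_mul]

lemma pd_cont {f : E N → ℝ} (hf : ContDiffOn ℝ 1 f (UU N)) (i : Fin N) :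
    ContinuousOn (pd f i) (UU N) :=
  (hf.continuousOn_fderiv_of_isOpen UU_open le_rfl).clm_apply continuousOn_const

lemma coord_cont (i : Fin N) : Continuous (fun x : E N => x i) := by fun_prop

lemma radial_test {F : Fin N → E N → ℝ} (hF : ∀ i, ContDiffOn ℝ 1 (F i) (UU N))
    {g g' : ℝ → ℝ} (hg : ∀ s, HasDerivAt g (g' s) s) (hg' : Continuous g')
    {r R : ℝ} (hr : 0 < r) (hR : R < 1)
    (hs : ∀ s, s ∉ Icc r R → g s = 0) (hs' : ∀ s, s ∉ Icc r R → g' s = 0) :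
    ∫ x : E N, (g (‖x‖ ^ 2) * ∑ i, pd (F i) i x + g' (‖x‖ ^ 2) * (2 * ∑ i, x i * F i x)) = 0 := by
  have hgc : Continuous g := continuous_iff_continuousAt.2 fun s => (hg s).continuousAt
  have h_int : ∀ i : Fin N, Integrable
      (fun x : E N => g (‖x‖ ^ 2) * pd (F i) i x + g' (‖x‖ ^ 2) * (2 * (x i * F i x))) := by
    intro i
    apply (integrable_rad hgc hr hR hs (pd_cont (hF i) i)).add
    apply integrable_rad hg' hr hR hs'
    exact continuousOn_const.mul ((coord_cont i).continuousOn.mul (hF i).continuousOn)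
  have hzero : ∀ i : Fin N, ∫ x : E N,
      (g (‖x‖ ^ 2) * pd (F i) i x + g' (‖x‖ ^ 2) * (2 * (x i * F i x))) = 0 := by
    intro i
    have hG := integrable_rad hgc hr hR hs (hF i).continuousOn
    have key := integral_bilinear_hasLineDerivAt_right_eq_neg_left_of_integrable (μ := volume)
      (f := fun _ : E N => (1:ℝ)) (f' := fun _ => (0:ℝ))
      (g := fun x : E N => g (‖x‖ ^ 2) * F i x)
      (g' := fun x : E N => g (‖x‖ ^ 2) * pd (F i) i x + g' (‖x‖ ^ 2) * (2 * (x i * F i x)))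
      (v := ee i) (B := ContinuousLinearMap.mul ℝ ℝ)
      (by simp) (by simpa using h_int i) (by simpa using hG) ?_ ?_
    · simpa using key
    · intro x _
      exact hasDerivAt_const _ _
    · intro x _
      by_cases hx : ‖x‖ ^ 2 ∈ Icc r R
      · have hxU := mem_UU_of_sq hr hR hx
        have hd : DifferentiableAt ℝ (F i) x :=
          ((hF i).contDiffAt (UU_open.mem_nhds hxU)).differentiableAt (by norm_num)
        have h1 := line_pd hd i
        have h2 : HasDerivAt (fun t : ℝ => g (‖x + t • ee i‖ ^ 2)) (g' (‖x‖ ^ 2) * (2 * x i)) 0 := by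
          have h3 := hg (‖x + (0:ℝ) • ee i‖ ^ 2)
          have := h3.comp (0:ℝ) (line_normsq x i)
          refine HasDerivAt.congr_deriv (f := fun t : ℝ => g (‖x + t • ee i‖ ^ 2)) this ?_
          simp
        have h4 := h2.mul h1
        have h5 : HasDerivAt (fun t : ℝ => g (‖x + t • ee i‖ ^ 2) * F i (x + t • ee i))
          (g (‖x‖ ^ 2) * pd (F i) i x + g' (‖x‖ ^ 2) * (2 * (x i * F i x))) 0 := by
          refine h4.congr_deriv ?_
          simp
          ring
        exact h5
      · rw [hs _ hx, hs' _ hx]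
        have hev : ∀ᶠ t : ℝ in 𝓝 0, ‖x + t • ee i‖ ^ 2 ∉ Icc r R := by
          have hc : ContinuousAt (fun t : ℝ => ‖x + t • ee i‖ ^ 2) 0 := by fun_prop
          refine hc.eventually_mem (s := (Icc r R)ᶜ) ?_
          apply isClosed_Icc.isOpen_compl.mem_nhds
          simpa using hx
        have h5 : HasDerivAt (fun t : ℝ => g (‖x + t • ee i‖ ^ 2) * F i (x + t • ee i))
          (0 * pd (F i) i x + 0 * (2 * (x i * F i x))) 0 := by
          have h0 : HasDerivAt (fun _ : ℝ => (0:ℝ)) 0 0 := hasDerivAt_const _ _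
          simp only [zero_mul, add_zero]
          apply h0.congr_of_eventuallyEq
          filter_upwards [hev] with t ht
          rw [hs _ ht, zero_mul]
        exact h5
  rw [show (fun x : E N => (g (‖x‖ ^ 2) * ∑ i, pd (F i) i x
        + g' (‖x‖ ^ 2) * (2 * ∑ i, x i * F i x)))
      = fun x => ∑ i, (g (‖x‖ ^ 2) * pd (F i) i x + g' (‖x‖ ^ 2) * (2 * (x i * F i x))) by
    funext x
    rw [Finset.sum_add_distrib, Finset.mul_sum, Finset.mul_sum, Finset.mul_sum]]
  rw [integral_finsetSum _ (fun i _ => h_int i)]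
  exact Finset.sum_eq_zero fun i _ => hzero i

/-! ### The Pohozaev vector field -/

lemma pd_C1 {u : E N → ℝ} (hu : ContDiffOn ℝ 2 u (UU N)) (i : Fin N) :
    ContDiffOn ℝ 1 (pd u i) (UU N) :=
  (hu.fderiv_of_isOpen UU_open (by norm_num)).clm_apply contDiffOn_const

lemma diff_at {f : E N → ℝ} (hf : ContDiffOn ℝ 1 f (UU N)) {x : E N} (hx : x ∈ UU N) :
    DifferentiableAt ℝ f x :=
  (hf.contDiffAt (UU_open.mem_nhds hx)).differentiableAt (by norm_num)

lemma pd_symm {u : E N → ℝ} (hu : ContDiffOn ℝ 2 u (UU N)) {x : E N} (hx : x ∈ UU N)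
    (i j : Fin N) : pd (pd u j) i x = pd (pd u i) j x := by
  have hc := hu.contDiffAt (UU_open.mem_nhds hx)
  have hs : IsSymmSndFDerivAt ℝ u x := hc.isSymmSndFDerivAt (by simp)
  have hd : DifferentiableAt ℝ (fderiv ℝ u) x :=
    (hc.fderiv_right (m := 1) (by norm_num)).differentiableAt (by norm_num)
  have key : ∀ k l : Fin N, pd (pd u k) l x = fderiv ℝ (fderiv ℝ u) x (ee l) (ee k) := by
    intro k l
    have h1 : HasFDerivAt (pd u k)
        ((ContinuousLinearMap.apply ℝ ℝ (ee k)).comp (fderiv ℝ (fderiv ℝ u) x)) x :=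
      (ContinuousLinearMap.apply ℝ ℝ (ee k)).hasFDerivAt.comp x hd.hasFDerivAt
    unfold pd at *
    rw [h1.fderiv]
    rfl
  rw [key, key]
  exact hs.eq _ _

lemma pd_eq {f : E N → ℝ} {x : E N} (h : DifferentiableAt ℝ f x) {i : Fin N} {d : ℝ}
    (hd : HasDerivAt (fun t : ℝ => f (x + t • ee i)) d 0) : pd f i x = d :=
  (line_pd h i).unique hd

def PF (u v A : E N → ℝ) (a b : ℝ) (i : Fin N) (x : E N) : ℝ :=
  (∑ j, x j * pd u j x) * pd v i x + (∑ j, x j * pd v j x) * pd u i x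
    - (∑ j, pd u j x * pd v j x) * x i + A x * x i + a * (v x * pd u i x) + b * (u x * pd v i x)

lemma coord_C1 (i : Fin N) : ContDiffOn ℝ 1 (fun x : E N => x i) (UU N) := by fun_prop

lemma PF_C1 {u v A : E N → ℝ} (a b : ℝ) (hu : ContDiffOn ℝ 2 u (UU N))
    (hv : ContDiffOn ℝ 2 v (UU N)) (hA : ContDiffOn ℝ 1 A (UU N)) (i : Fin N) :
    ContDiffOn ℝ 1 (PF u v A a b i) (UU N) := by
  have h1 := pd_C1 hu
  have h2 := pd_C1 hv
  have h3 := hu.of_le (m := 1) (by norm_num)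
  have h4 := hv.of_le (m := 1) (by norm_num)
  have h5 := coord_C1 (N := N)
  unfold PF
  exact ((((((ContDiffOn.sum fun j _ => (h5 j).mul (h1 j)).mul (h2 i)).add
    ((ContDiffOn.sum fun j _ => (h5 j).mul (h2 j)).mul (h1 i))).sub
    ((ContDiffOn.sum fun j _ => (h1 j).mul (h2 j)).mul (h5 i))).add
    (hA.mul (h5 i))).add (contDiffOn_const.mul (h4.mul (h1 i)))).add
    (contDiffOn_const.mul (h3.mul (h2 i)))

lemma PF_div {u v A : E N → ℝ} (a b : ℝ) (hu : ContDiffOn ℝ 2 u (UU N))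
    (hv : ContDiffOn ℝ 2 v (UU N)) (hA : ContDiffOn ℝ 1 A (UU N)) {x : E N} (hx : x ∈ UU N) :
    ∑ i, pd (PF u v A a b i) i x =
      (∑ j, x j * pd u j x) * lap v x + (∑ j, x j * pd v j x) * lap u x
      + (2 - N + a + b) * (∑ j, pd u j x * pd v j x) + N * A x + ∑ i, x i * pd A i x
      + a * (v x * lap u x) + b * (u x * lap v x) := by
  have h1 := pd_C1 hu
  have h2 := pd_C1 hv
  have h3 := hu.of_le (m := 1) (by norm_num)
  have h4 := hv.of_le (m := 1) (by norm_num)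
  have lu : lap u x = ∑ i, pd (pd u i) i x := rfl
  have lv : lap v x = ∑ i, pd (pd v i) i x := rfl
  have key : ∀ i, pd (PF u v A a b i) i x =
      (pd u i x * pd v i x + (∑ j, x j * pd (pd u j) i x * pd v i x)
        + (∑ j, x j * pd u j x) * pd (pd v i) i x)
      + (pd u i x * pd v i x + (∑ j, x j * pd (pd v j) i x * pd u i x)
        + (∑ j, x j * pd v j x) * pd (pd u i) i x)
      - ((∑ j, x i * pd (pd u j) i x * pd v j x) + (∑ j, x i * pd (pd v j) i x * pd u j x)
        + (∑ j, pd u j x * pd v j x))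
      + (x i * pd A i x + A x) + a * (pd u i x * pd v i x + v x * pd (pd u i) i x)
      + b * (pd u i x * pd v i x + u x * pd (pd v i) i x) := by
    intro i
    apply pd_eq (diff_at (PF_C1 a b hu hv hA i) hx)
    have e0 : x + (0:ℝ) • ee i = x := by simp
    have S : ∀ w : E N → ℝ, ContDiffOn ℝ 2 w (UU N) →
        HasDerivAt (fun t : ℝ => ∑ j, (x + t • ee i) j * pd w j (x + t • ee i))
          (pd w i x + ∑ j, x j * pd (pd w j) i x) 0 := by
      intro w hw
      have := HasDerivAt.fun_sum (u := Finset.univ) fun j _ =>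
        (line_coord x i j).fun_mul (line_pd (diff_at (pd_C1 hw j) hx) i)
      refine this.congr_deriv ?_
      rw [e0, Finset.sum_add_distrib]
      simp
    have D : HasDerivAt (fun t : ℝ => ∑ j, pd u j (x + t • ee i) * pd v j (x + t • ee i))
        ((∑ j, pd (pd u j) i x * pd v j x) + ∑ j, pd u j x * pd (pd v j) i x) 0 := by
      have := HasDerivAt.fun_sum (u := Finset.univ) fun j _ =>
        (line_pd (diff_at (h1 j) hx) i).fun_mul (line_pd (diff_at (h2 j) hx) i)
      refine this.congr_deriv ?_
      rw [e0, Finset.sum_add_distrib]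
    have Du := line_pd (diff_at (h1 i) hx) i
    have Dv := line_pd (diff_at (h2 i) hx) i
    have Xi := line_coord x i i
    have all := ((((((S u hu).fun_mul Dv).fun_add ((S v hv).fun_mul Du)).fun_sub (D.fun_mul Xi)).fun_add
      ((line_pd (diff_at hA hx) i).fun_mul Xi)).fun_add
      (((line_pd (diff_at h4 hx) i).fun_mul Du).const_mul a)).fun_add
      (((line_pd (diff_at h3 hx) i).fun_mul Dv).const_mul b)
    refine HasDerivAt.congr_deriv (f := fun t : ℝ => PF u v A a b i (x + t • ee i)) all ?_
    rw [e0]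
    have e1 : ∑ j, pd u j x * pd (pd v j) i x = ∑ j, pd (pd v j) i x * pd u j x :=
      Finset.sum_congr rfl fun j _ => mul_comm _ _
    have f1 : ∀ (c : ℝ) (w z : Fin N → ℝ), ∑ j, c * w j * z j = c * ∑ j, w j * z j := by
      intro c w z
      rw [Finset.mul_sum]
      exact Finset.sum_congr rfl fun j _ => mul_assoc _ _ _
    rw [e1, f1, f1, ← Finset.sum_mul, ← Finset.sum_mul]
    simp only [if_true]
    ring
  rw [Finset.sum_congr rfl fun i _ => key i]
  simp only [Finset.sum_add_distrib, Finset.sum_sub_distrib, ← Finset.mul_sum]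
  have sw1 : ∑ i, ∑ j, x i * pd (pd u j) i x * pd v j x
      = ∑ i, ∑ j, x j * pd (pd u j) i x * pd v i x := by
    rw [Finset.sum_comm]
    refine Finset.sum_congr rfl fun i _ => Finset.sum_congr rfl fun j _ => ?_
    rw [pd_symm hu hx]
  have sw2 : ∑ i, ∑ j, x i * pd (pd v j) i x * pd u j x
      = ∑ i, ∑ j, x j * pd (pd v j) i x * pd u i x := by
    rw [Finset.sum_comm]
    refine Finset.sum_congr rfl fun i _ => Finset.sum_congr rfl fun j _ => ?_
    rw [pd_symm hv hx]
  have sw1' : ∑ i, x i * ∑ j, pd (pd u j) i x * pd v j x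
      = ∑ i, ∑ j, x j * pd (pd u j) i x * pd v i x := by
    rw [← sw1]
    refine Finset.sum_congr rfl fun i _ => ?_
    rw [Finset.mul_sum]
    exact Finset.sum_congr rfl fun j _ => (mul_assoc _ _ _).symm
  have sw2' : ∑ i, x i * ∑ j, pd (pd v j) i x * pd u j x
      = ∑ i, ∑ j, x j * pd (pd v j) i x * pd u i x := by
    rw [← sw2]
    refine Finset.sum_congr rfl fun i _ => ?_
    rw [Finset.mul_sum]
    exact Finset.sum_congr rfl fun j _ => (mul_assoc _ _ _).symm
  first | rw [sw1, sw2] | rw [sw1', sw2']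
  rw [lu, lv]
  simp only [Finset.sum_const, Finset.card_univ, Fintype.card_fin, nsmul_eq_mul]
  ring

/-- The potential term. -/
def pot (α p : ℝ) (u : E N → ℝ) (x : E N) : ℝ := ‖x‖ ^ α * u x ^ (p + 1)

lemma pot_C1 {α p : ℝ} {u : E N → ℝ} (hu : ContDiffOn ℝ 2 u (UU N))
    (hpos : ∀ x ∈ UU N, 0 < u x) : ContDiffOn ℝ 1 (pot α p u) (UU N) := by
  have h3 := hu.of_le (m := 1) (by norm_num)
  intro x hx
  have hx0 := (mem_UU.1 hx).2
  unfold pot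
  apply ContDiffWithinAt.mul
  · exact (((contDiffAt_norm ℝ hx0)).rpow_const_of_ne (by simpa using hx0)).contDiffWithinAt
  · exact (h3 x hx).rpow_const_of_ne (hpos x hx).ne'

lemma sum_sq (x : E N) : ∑ i, x i * x i = ‖x‖ ^ 2 := by
  rw [EuclideanSpace.norm_sq_eq]
  exact Finset.sum_congr rfl fun i _ => by rw [Real.norm_eq_abs, sq_abs]; ring

lemma pot_euler {α p : ℝ} {u : E N → ℝ} (hu : ContDiffOn ℝ 2 u (UU N))
    (hpos : ∀ x ∈ UU N, 0 < u x) {x : E N} (hx : x ∈ UU N) :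
    ∑ i, x i * pd (pot α p u) i x =
      α * pot α p u x + (p + 1) * (‖x‖ ^ α * u x ^ p) * ∑ i, x i * pd u i x := by
  have h3 := hu.of_le (m := 1) (by norm_num)
  have hx0 := (mem_UU.1 hx).2
  have hn : 0 < ‖x‖ := norm_pos_iff.2 hx0
  have hup := hpos x hx
  have key : ∀ i, pd (pot α p u) i x =
      (α * (‖x‖ ^ α / ‖x‖ ^ 2) * u x ^ (p + 1)) * x i
        + (p + 1) * (‖x‖ ^ α * u x ^ p) * pd u i x := by
    intro i
    apply pd_eq (diff_at (pot_C1 hu hpos) hx)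
    have e0 : x + (0:ℝ) • ee i = x := by simp
    have hf : (fun t : ℝ => pot α p u (x + t • ee i)) =
        fun t : ℝ => (‖x + t • ee i‖ ^ 2) ^ (α / 2) * u (x + t • ee i) ^ (p + 1) := by
      funext t
      unfold pot
      congr 1
      rw [← Real.rpow_natCast, ← Real.rpow_mul (norm_nonneg _)]
      congr 1
      push_cast
      ring
    rw [hf]
    have d1 := (line_normsq x i).rpow_const (p := α / 2) (Or.inl (by rw [e0]; positivity))
    have d2 := (line_pd (diff_at h3 hx) i).rpow_const (p := p + 1) (Or.inl (by rw [e0]; exact hup.ne'))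
    refine (d1.fun_mul d2).congr_deriv ?_
    rw [e0]
    have e1 : (‖x‖ ^ 2) ^ (α / 2) = ‖x‖ ^ α := by
      rw [← Real.rpow_natCast, ← Real.rpow_mul (norm_nonneg _)]
      congr 1
      push_cast
      ring
    have e2 : (‖x‖ ^ 2) ^ (α / 2 - 1) = ‖x‖ ^ α / ‖x‖ ^ 2 := by
      rw [Real.rpow_sub (by positivity), e1, Real.rpow_one]
    rw [e1, e2, add_sub_cancel_right]
    ring
  rw [Finset.sum_congr rfl fun i _ => by rw [key i]]
  have : ∀ i, x i * ((α * (‖x‖ ^ α / ‖x‖ ^ 2) * u x ^ (p + 1)) * x i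
        + (p + 1) * (‖x‖ ^ α * u x ^ p) * pd u i x) =
      (α * (‖x‖ ^ α / ‖x‖ ^ 2) * u x ^ (p + 1)) * (x i * x i)
        + (p + 1) * (‖x‖ ^ α * u x ^ p) * (x i * pd u i x) := fun i => by ring
  rw [Finset.sum_congr rfl fun i _ => this i, Finset.sum_add_distrib, ← Finset.mul_sum,
    ← Finset.mul_sum, sum_sq]
  congr 1
  unfold pot
  field_simp

/-! ### Energy estimate near the singularity -/

lemma integrable_inv_sq (hN : 3 ≤ N) :
    IntegrableOn (fun x : E N => 1 / ‖x‖ ^ 2) (ball 0 1) := by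
  have : Nonempty (Fin N) := ⟨⟨0, by omega⟩⟩
  have : Nontrivial (E N) := inferInstance
  rw [integrableOn_fun_norm_addHaar volume (f := fun y : ℝ => 1 / y ^ 2)]
  have hc : IntegrableOn (fun y : ℝ => y ^ (N - 3)) (Ioo 0 1) :=
    ((by fun_prop : Continuous fun y : ℝ => y ^ (N - 3)).integrableOn_Icc (a := 0) (b := 1)).mono_set
      Ioo_subset_Icc_self
  refine hc.congr_fun ?_ measurableSet_Ioo
  intro y hy
  have h0 : y ≠ 0 := hy.1.ne'
  simp only [finrank_euclideanSpace, Fintype.card_fin, smul_eq_mul]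
  have : N - 1 = (N - 3) + 2 := by omega
  rw [this, pow_add]
  field_simp

lemma pd_grad (u : E N → ℝ) (x : E N) (j : Fin N) : pd u j x = gradient u x j := by
  unfold pd gradient
  have h : fderiv ℝ u x (ee j) = inner ℝ ((InnerProductSpace.toDual ℝ (E N)).symm (fderiv ℝ u x)) (ee j) := by
    rw [InnerProductSpace.toDual_symm_apply]
  rw [h, EuclideanSpace.inner_single_right]
  simp

lemma sum_pd_sq (u : E N → ℝ) (x : E N) : ∑ j, pd u j x * pd u j x = ‖gradient u x‖ ^ 2 := by
  rw [← sum_sq]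
  simp only [pd_grad]

lemma inner_eq (a b : E N) : inner ℝ a b = ∑ j, a j * b j := by
  rw [PiLp.inner_apply]
  exact Finset.sum_congr rfl fun j _ => by simp [mul_comm]

lemma sum_x_pd (u : E N → ℝ) (x : E N) : ∑ j, x j * pd u j x = inner ℝ x (gradient u x) := by
  rw [inner_eq]
  simp only [pd_grad]

lemma sum_pd_pd (u v : E N → ℝ) (x : E N) :
    ∑ j, pd u j x * pd v j x = inner ℝ (gradient u x) (gradient v x) := by
  rw [inner_eq]
  simp only [pd_grad]

lemma radial_int {F : Fin N → E N → ℝ} (hF : ∀ i, ContDiffOn ℝ 1 (F i) (UU N))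
    {g g' : ℝ → ℝ} (hg : Continuous g) (hg' : Continuous g')
    {r R : ℝ} (hr : 0 < r) (hR : R < 1)
    (hs : ∀ s, s ∉ Icc r R → g s = 0) (hs' : ∀ s, s ∉ Icc r R → g' s = 0) :
    Integrable (fun x : E N => g (‖x‖ ^ 2) * ∑ i, pd (F i) i x) ∧
    Integrable (fun x : E N => g' (‖x‖ ^ 2) * (2 * ∑ i, x i * F i x)) := by
  constructor
  · exact integrable_rad hg hr hR hs (continuousOn_finsetSum _ fun i _ => pd_cont (hF i) i)
  · refine integrable_rad hg' hr hR hs' (continuousOn_const.mul (continuousOn_finsetSum _ fun i _ => ?_))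
    exact (coord_cont i).continuousOn.mul (hF i).continuousOn

lemma gradsq_cont {u : E N → ℝ} (hu : ContDiffOn ℝ 2 u (UU N)) :
    ContinuousOn (fun x => ‖gradient u x‖ ^ 2) (UU N) := by
  have h := fun j => (pd_C1 hu j).continuousOn
  refine (continuousOn_finsetSum Finset.univ fun j _ => (h j).mul (h j)).congr ?_
  intro x _
  exact (sum_pd_sq u x).symm

lemma energy_bound (hN : 3 ≤ N) {u : E N → ℝ} (hu : ContDiffOn ℝ 2 u (UU N)) {M : ℝ}
    (hM : ∀ x ∈ UU N, |u x| ≤ M) (hlap : ∀ x ∈ UU N, lap u x ≤ 0)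
    {δ : ℝ} (hδ : 0 < δ) (hδ1 : δ < 1 / 2) {ε : ℝ} (hε : 0 < ε) :
    ∫ x : E N, gc δ ε (‖x‖ ^ 2) ^ 2 * ‖gradient u x‖ ^ 2 ≤
      ∫ x in ball (0 : E N) 1, 64 * M ^ 2 * (1 / δ + 2) ^ 2 * (1 / ‖x‖ ^ 2) := by
  have h1 := pd_C1 hu
  have h3 := hu.of_le (m := 1) (by norm_num)
  set F : Fin N → E N → ℝ := fun i x => (M - u x) * pd u i x with hFdef
  have hF : ∀ i, ContDiffOn ℝ 1 (F i) (UU N) := fun i => (contDiffOn_const.sub h3).mul (h1 i)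
  have hdiv : ∀ x ∈ UU N, ∑ i, pd (F i) i x = -‖gradient u x‖ ^ 2 + (M - u x) * lap u x := by
    intro x hx
    have key : ∀ i, pd (F i) i x = -(pd u i x * pd u i x) + (M - u x) * pd (pd u i) i x := by
      intro i
      apply pd_eq (diff_at (hF i) hx)
      have := ((line_pd (diff_at h3 hx) i).const_sub M).fun_mul (line_pd (diff_at (h1 i) hx) i)
      refine this.congr_deriv ?_
      simp
    rw [Finset.sum_congr rfl fun i _ => key i, Finset.sum_add_distrib, Finset.sum_neg_distrib,
      sum_pd_sq, ← Finset.mul_sum]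
    rfl
  set k : ℝ → ℝ := fun s => gc δ ε s ^ 2
  set k' : ℝ → ℝ := fun s => 2 * gc δ ε s * gd δ ε s
  have hk : ∀ s, HasDerivAt k (k' s) s := by
    intro s
    have := (gc_hasDerivAt δ ε s).fun_pow 2
    refine this.congr_deriv ?_
    simp [k']
  have hkc : Continuous k := (gc_cont δ ε).pow 2
  have hkc' : Continuous k' := (continuous_const.mul (gc_cont δ ε)).mul (gd_cont δ ε)
  have hs : ∀ s, s ∉ Icc ε (1 - δ) → k s = 0 := fun s h => by simp [k, gc_supp hδ hε s h]
  have hs' : ∀ s, s ∉ Icc ε (1 - δ) → k' s = 0 := fun s h => by simp [k', gc_supp hδ hε s h]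
  have hR : 1 - δ < 1 := by linarith
  have hz := radial_test hF hk hkc' hε hR hs hs'
  obtain ⟨i1, i2⟩ := radial_int hF hkc hkc' hε hR hs hs'
  have i3 := integrable_rad hkc hε hR hs (gradsq_cont hu)
  have i4 : Integrable (fun x : E N => (ball (0 : E N) 1).indicator
      (fun x => 64 * M ^ 2 * (1 / δ + 2) ^ 2 * (1 / ‖x‖ ^ 2)) x) := by
    rw [integrable_indicator_iff measurableSet_ball]
    exact (integrable_inv_sq hN).const_mul _
  have hle : ∫ x : E N, (k (‖x‖ ^ 2) * ∑ i, pd (F i) i x + k' (‖x‖ ^ 2) * (2 * ∑ i, x i * F i x))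
      ≤ ∫ x : E N, ((ball (0 : E N) 1).indicator
      (fun x => 64 * M ^ 2 * (1 / δ + 2) ^ 2 * (1 / ‖x‖ ^ 2)) x
        - k (‖x‖ ^ 2) * ‖gradient u x‖ ^ 2) / 2 := by
    apply integral_mono (i1.add i2) ((i4.sub i3).div_const 2)
    intro x
    simp only [Pi.add_apply, Pi.sub_apply]
    by_cases hx : ‖x‖ ^ 2 ∈ Icc ε (1 - δ)
    swap
    · rw [hs _ hx, hs' _ hx]
      simp only [zero_mul, add_zero, sub_zero]
      apply div_nonneg _ (by norm_num)
      apply indicator_nonneg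
      intro y _
      positivity
    have hxU := mem_UU_of_sq hε hR hx
    rw [indicator_of_mem hxU.1, hdiv x hxU]
    have hS : ∑ i, x i * F i x = (M - u x) * inner ℝ x (gradient u x) := by
      rw [← sum_x_pd, Finset.mul_sum]
      exact Finset.sum_congr rfl fun i _ => by simp only [hFdef]; ring
    rw [hS]
    have hn : 0 < ‖x‖ ^ 2 := lt_of_lt_of_le hε hx.1
    have hab := hM x hxU
    have hu1 := (abs_le.1 hab).1
    have hu2 := (abs_le.1 hab).2
    have hl := hlap x hxU
    have hin : (inner ℝ x (gradient u x)) ^ 2 ≤ ‖x‖ ^ 2 * ‖gradient u x‖ ^ 2 := by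
      rw [← mul_pow]
      apply sq_le_sq'
      · exact (abs_le.1 (abs_real_inner_le_norm x (gradient u x))).1
      · exact (abs_le.1 (abs_real_inner_le_norm x (gradient u x))).2
    have hgd := gd_bound hδ hε hn
    set S := inner ℝ x (gradient u x)
    set Q := ‖gradient u x‖ ^ 2
    set s := ‖x‖ ^ 2
    set g := gc δ ε s with hg
    set d := gd δ ε s with hd
    set C := 1 / δ + 2
    have hQ : 0 ≤ Q := sq_nonneg _
    have hks : k s = g ^ 2 := rfl
    have hks' : k' s = 2 * g * d := rfl
    rw [hks, hks']
    set K := M - u x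
    have hK0 : 0 ≤ K := by simp only [K]; linarith
    have hK2 : K ≤ 2 * M := by simp only [K]; linarith
    have a1 : g ^ 2 * (K * lap u x) ≤ 0 :=
      mul_nonpos_of_nonneg_of_nonpos (sq_nonneg _) (mul_nonpos_of_nonneg_of_nonpos hK0 hl)
    have a2 : d ^ 2 ≤ C ^ 2 / s ^ 2 := by
      rw [← div_pow, ← sq_abs d]
      exact pow_le_pow_left₀ (abs_nonneg _) hgd 2
    -- young
    have a3 : 4 * (g * d * (K * S)) ≤ g ^ 2 * (S ^ 2 / s) / 2 + 8 * (d ^ 2 * K ^ 2 * s) := by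
      have : 0 ≤ (g * S - 4 * (d * K * s)) ^ 2 / s / 2 := by positivity
      have e : (g * S - 4 * (d * K * s)) ^ 2 / s / 2 =
        g ^ 2 * (S ^ 2 / s) / 2 + 8 * (d ^ 2 * K ^ 2 * s) - 4 * (g * d * (K * S)) := by
        field_simp
        ring
      linarith
    have a4 : S ^ 2 / s ≤ Q := by
      rw [div_le_iff₀ hn]; linarith
    have a5 : g ^ 2 * (S ^ 2 / s) ≤ g ^ 2 * Q := mul_le_mul_of_nonneg_left a4 (sq_nonneg _)
    have a6 : d ^ 2 * K ^ 2 * s ≤ (C ^ 2 / s ^ 2) * (2 * M) ^ 2 * s := by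
      gcongr
    have a7 : (C ^ 2 / s ^ 2) * (2 * M) ^ 2 * s = 4 * (M ^ 2 * C ^ 2 * (1 / s)) := by
      field_simp
      ring
    nlinarith
  rw [hz, integral_div, integral_sub i4 i3, integral_indicator measurableSet_ball] at hle
  have : ∫ x : E N, k (‖x‖ ^ 2) * ‖gradient u x‖ ^ 2
    = ∫ x : E N, gc δ ε (‖x‖ ^ 2) ^ 2 * ‖gradient u x‖ ^ 2 := rfl
  linarith

lemma energy (hN : 3 ≤ N) {u : E N → ℝ} (hu : ContDiffOn ℝ 2 u (UU N)) {M : ℝ}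
    (hM : ∀ x ∈ UU N, |u x| ≤ M) (hlap : ∀ x ∈ UU N, lap u x ≤ 0)
    {δ : ℝ} (hδ : 0 < δ) (hδ1 : δ < 1 / 2) :
    IntegrableOn (fun x => ‖gradient u x‖ ^ 2) {x : E N | ‖x‖ ^ 2 ≤ 1 - 2 * δ} := by
  set K := {x : E N | ‖x‖ ^ 2 ≤ 1 - 2 * δ}
  have hKc : IsClosed K := isClosed_le (by fun_prop) continuous_const
  have : Nonempty (Fin N) := ⟨⟨0, by omega⟩⟩
  have : Nontrivial (E N) := inferInstance
  let ph : ℕ → Set (E N) := fun n => {x | 2 * (1 / ((n:ℝ) + 1)) ≤ ‖x‖ ^ 2}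
  have hph : ∀ n, IsClosed (ph n) := fun n => isClosed_le continuous_const (by fun_prop)
  have hcov : AECover (volume.restrict K) atTop ph := by
    refine ⟨?_, fun n => (hph n).measurableSet⟩
    apply ae_restrict_of_ae
    have h0 : ∀ᵐ x : E N, x ≠ 0 := by
      simp [ae_iff]
    filter_upwards [h0] with x hx
    have hx2 : 0 < ‖x‖ ^ 2 := by positivity
    have ht : Tendsto (fun n : ℕ => 2 * (1 / ((n:ℝ) + 1))) atTop (𝓝 (2 * 0)) :=
      tendsto_one_div_add_atTop_nhds_zero_nat.const_mul 2
    rw [mul_zero] at ht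
    exact (ht.eventually_lt_const hx2).mono fun n hn => hn.le
  have hsub : ∀ n, ph n ∩ K ⊆ UU N := by
    intro n x hx
    have hp : (0:ℝ) < 2 * (1 / ((n:ℝ) + 1)) := by positivity
    exact mem_UU_of_sq hp (by linarith) ⟨hx.1, hx.2⟩
  have hcpt : ∀ n, IsCompact (ph n ∩ K) := by
    intro n
    apply (isCompact_closedBall (0 : E N) 1).of_isClosed_subset ((hph n).inter hKc)
    intro x hx
    have := (mem_UU.1 (hsub n hx)).1
    simpa using this.le
  have hκ := tT_one_pos
  refine hcov.integrable_of_integral_bounded_of_nonneg_ae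
    ((∫ x in ball (0 : E N) 1, 64 * M ^ 2 * (1 / δ + 2) ^ 2 * (1 / ‖x‖ ^ 2)) / (tT 1 * tT 1) ^ 2) ?_ ?_ ?_
  · intro n
    rw [IntegrableOn, Measure.restrict_restrict (hph n).measurableSet]
    exact ((gradsq_cont hu).mono (hsub n)).integrableOn_compact (hcpt n)
  · exact Eventually.of_forall fun x => sq_nonneg _
  · refine Eventually.of_forall fun n => ?_
    rw [Measure.restrict_restrict (hph n).measurableSet, le_div_iff₀ (by positivity)]
    have hε : (0:ℝ) < 1 / ((n:ℝ) + 1) := by positivity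
    refine le_trans ?_ (energy_bound hN hu hM hlap hδ hδ1 hε)
    have i3 := integrable_rad (k := fun s => gc δ (1 / ((n:ℝ) + 1)) s ^ 2) ((gc_cont δ _).pow 2) hε
      (by linarith : 1 - δ < 1) (fun s h => by rw [gc_supp hδ hε s h]; norm_num) (gradsq_cont hu)
    refine le_trans (le_of_eq ?_) (setIntegral_le_integral (s := ph n ∩ K) i3 ?_)
    · rw [mul_comm, ← integral_const_mul]
      apply setIntegral_congr_fun (((hph n).inter hKc).measurableSet)
      intro x hx
      simp only
      rw [gc_plateau hδ hε hx.1 hx.2]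
    · exact Eventually.of_forall fun x => by positivity

/-! ### Hopf lemma -/

lemma local_min_pd {w : E N → ℝ} (hw : ContDiffOn ℝ 2 w (UU N)) {x : E N} (hx : x ∈ UU N)
    (hmin : IsLocalMin w x) (i : Fin N) : 0 ≤ pd (pd w i) i x := by
  by_contra hneg
  rw [not_le] at hneg
  have h3 := hw.of_le (m := 1) (by norm_num)
  set f : ℝ → ℝ := fun t => w (x + t • ee i) with hf
  have e0 : x + (0:ℝ) • ee i = x := by simp
  have hcl : Continuous (fun t : ℝ => x + t • ee i) := by fun_prop
  have hcont : ContinuousAt (fun t : ℝ => x + t • ee i) 0 := hcl.continuousAt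
  have hev : ∀ᶠ t : ℝ in 𝓝 0, x + t • ee i ∈ UU N := by
    apply hcont.eventually_mem
    rw [e0]
    exact UU_open.mem_nhds hx
  have hder : deriv f =ᶠ[𝓝 0] fun t => pd w i (x + t • ee i) := by
    filter_upwards [hev] with t ht
    have h1 := line_pd (diff_at h3 ht) i
    have h2 : HasDerivAt (fun s : ℝ => w (x + t • ee i + (s - t) • ee i)) (pd w i (x + t • ee i)) t := by
      have h4 : HasDerivAt (fun s : ℝ => s - t) 1 t := (hasDerivAt_id t).sub_const t
      have h1' : HasDerivAt (fun s : ℝ => w (x + t • ee i + s • ee i)) (pd w i (x + t • ee i)) (t - t) := by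
        rw [sub_self]; exact h1
      have h5 := HasDerivAt.comp (h₂ := fun s : ℝ => w (x + t • ee i + s • ee i))
        (h := fun s : ℝ => s - t) t h1' h4
      rw [mul_one] at h5
      exact h5
    have h6 : (fun s : ℝ => w (x + t • ee i + (s - t) • ee i)) = f := by
      funext s
      simp only [hf]
      congr 1
      rw [add_assoc, ← add_smul]
      congr 2
      ring
    rw [h6] at h2
    exact h2.deriv
  have hdd : deriv (deriv f) 0 = pd (pd w i) i x := by
    rw [hder.deriv_eq]
    exact (line_pd (diff_at (pd_C1 hw i) hx) i).deriv
  have hfmin : IsLocalMin f 0 := by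
    have : IsLocalMin w (x + (0:ℝ) • ee i) := by rw [e0]; exact hmin
    exact this.comp_continuous (g := fun t : ℝ => x + t • ee i) hcont
  have hfc : ContinuousAt f 0 := (line_pd (diff_at h3 hx) i).continuousAt
  have hmax : IsLocalMax f 0 :=
    isLocalMax_of_deriv_deriv_neg (by rw [hdd]; exact hneg) hfmin.deriv_eq_zero hfc
  have hconst : f =ᶠ[𝓝 0] fun _ => f 0 := by
    filter_upwards [hfmin, hmax] with t h1 h2
    exact le_antisymm h2 h1
  have hd1 : deriv f =ᶠ[𝓝 0] fun _ => 0 := by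
    have := hconst.deriv
    refine this.trans ?_
    simp
  have : deriv (deriv f) 0 = 0 := by
    rw [hd1.deriv_eq]
    simp
  rw [hdd] at this
  linarith

def barr (k : ℝ) (x : E N) : ℝ := Real.exp (-(k * ‖x‖ ^ 2))

lemma barr_C2 (k : ℝ) : ContDiff ℝ 2 (barr k : E N → ℝ) := by
  unfold barr
  exact ((contDiff_const.mul (contDiff_norm_sq ℝ)).neg).exp

lemma line_barr (k : ℝ) (x : E N) (i : Fin N) :
    HasDerivAt (fun t : ℝ => barr k (x + t • ee i)) (-(2 * k) * x i * barr k x) 0 := by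
  have := (((line_normsq x i).const_mul k).fun_neg).exp
  refine HasDerivAt.congr_deriv (f := fun t : ℝ => barr k (x + t • ee i)) this ?_
  simp [barr]
  ring

lemma lap_sub_barr {u : E N → ℝ} (hu : ContDiffOn ℝ 2 u (UU N)) (k c d : ℝ) {x : E N}
    (hx : x ∈ UU N) :
    ∑ i, pd (pd (fun y => u y - c * (barr k y - d)) i) i x =
      lap u x - c * ((4 * k ^ 2 * ‖x‖ ^ 2 - 2 * k * N) * barr k x) := by
  have h3 := hu.of_le (m := 1) (by norm_num)
  set w := fun y => u y - c * (barr k y - d) with hw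
  have hwC : ContDiffOn ℝ 2 w (UU N) :=
    hu.sub (contDiffOn_const.mul ((barr_C2 k).contDiffOn.sub contDiffOn_const))
  have hw1 := hwC.of_le (m := 1) (by norm_num)
  have hp : ∀ i, ∀ y ∈ UU N, pd w i y = pd u i y + c * (2 * k) * (y i * barr k y) := by
    intro i y hy
    apply pd_eq (diff_at hw1 hy)
    refine ((line_pd (diff_at h3 hy) i).fun_sub
      (((line_barr k y i).sub_const d).const_mul c)).congr_deriv ?_
    ring
  have hpp : ∀ i, pd (pd w i) i x = pd (pd u i) i x +
      c * (2 * k) * barr k x - c * (4 * k ^ 2) * barr k x * (x i * x i) := by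
    intro i
    apply pd_eq (diff_at (pd_C1 hwC i) hx)
    have h := (line_pd (diff_at (pd_C1 hu i) hx) i).fun_add
      (((line_coord x i i).fun_mul (line_barr k x i)).const_mul (c * (2 * k)))
    have hcl : Continuous (fun t : ℝ => x + t • ee i) := by fun_prop
    have hev : ∀ᶠ t : ℝ in 𝓝 0, x + t • ee i ∈ UU N := by
      apply hcl.continuousAt.eventually_mem
      simpa using UU_open.mem_nhds hx
    have h' := h.congr_of_eventuallyEq (f₁ := fun t : ℝ => pd w i (x + t • ee i))
      (hev.mono fun t ht => hp i _ ht)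
    refine h'.congr_deriv ?_
    simp
    ring
  have hs : ∑ i, c * (4 * k ^ 2) * barr k x * (x i * x i)
      = c * (4 * k ^ 2) * barr k x * ‖x‖ ^ 2 := by
    rw [← Finset.mul_sum, sum_sq]
  rw [Finset.sum_congr rfl fun i _ => hpp i, Finset.sum_sub_distrib, Finset.sum_add_distrib, hs]
  have : ∑ i, pd (pd u i) i x = lap u x := rfl
  rw [this]
  simp
  ring

lemma annulus_compact : IsCompact {x : E N | 1 / 2 ≤ ‖x‖ ∧ ‖x‖ ≤ 1} := by
  apply (isCompact_closedBall (0 : E N) 1).of_isClosed_subset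
  · exact (isClosed_le continuous_const continuous_norm).inter
      (isClosed_le continuous_norm continuous_const)
  · intro x hx
    simpa using hx.2

lemma hopf (hN : 3 ≤ N) {u : E N → ℝ} (huc : ContinuousOn u (closedBall 0 1))
    (hu : ContDiffOn ℝ 2 u (UU N)) (hpos : ∀ x ∈ UU N, 0 < u x)
    (hbd : ∀ x : E N, ‖x‖ = 1 → u x = 0) (hlap : ∀ x ∈ UU N, lap u x ≤ 0) :
    ∃ c : ℝ, 0 < c ∧ ∀ x : E N, 1 / 2 ≤ ‖x‖ → ‖x‖ ≤ 1 → c * (1 - ‖x‖ ^ 2) ≤ u x := by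
  have : Nonempty (Fin N) := ⟨⟨0, by omega⟩⟩
  have : Nontrivial (E N) := inferInstance
  -- min on the inner sphere
  have hsph : (sphere (0 : E N) (1 / 2)).Nonempty := NormedSpace.sphere_nonempty.2 (by norm_num)
  have hsub : sphere (0 : E N) (1 / 2) ⊆ closedBall 0 1 := by
    intro x hx
    simp at hx ⊢
    rw [hx]; norm_num
  obtain ⟨z, hz, hzmin⟩ := (isCompact_sphere (0 : E N) (1 / 2)).exists_isMinOn hsph (huc.mono hsub)
  have hzU : z ∈ UU N := by
    rw [mem_UU]
    have : ‖z‖ = 1 / 2 := by simpa using hz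
    refine ⟨by rw [this]; norm_num, ?_⟩
    rintro rfl
    simp at this
  set m := u z
  have hm : 0 < m := hpos z hzU
  set k : ℝ := 2 * N + 1 with hk
  have hk0 : 0 < k := by positivity
  set d := Real.exp (-k) with hd
  set w : E N → ℝ := fun y => u y - m * (barr k y - d) with hw
  have hwc : ContinuousOn w (closedBall 0 1) :=
    huc.sub (continuousOn_const.mul ((barr_C2 k).continuous.continuousOn.sub continuousOn_const))
  have hwC : ContDiffOn ℝ 2 w (UU N) :=
    hu.sub (contDiffOn_const.mul ((barr_C2 k).contDiffOn.sub contDiffOn_const))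
  have hwpos : ∀ x : E N, 1 / 2 ≤ ‖x‖ → ‖x‖ ≤ 1 → 0 ≤ w x := by
    have hne : {x : E N | 1 / 2 ≤ ‖x‖ ∧ ‖x‖ ≤ 1}.Nonempty := by
      refine ⟨z, ?_⟩
      have : ‖z‖ = 1 / 2 := by simpa using hz
      simp only [mem_ofPred_eq, this]; norm_num
    obtain ⟨y, hy, hymin⟩ := annulus_compact.exists_isMinOn hne
      (hwc.mono fun x hx => by simpa using hx.2)
    intro x h1 h2
    refine le_trans ?_ (hymin (show x ∈ {x : E N | 1 / 2 ≤ ‖x‖ ∧ ‖x‖ ≤ 1} from ⟨h1, h2⟩))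
    rcases eq_or_lt_of_le hy.2 with h | h
    · have : w y = 0 := by simp [hw, hbd y h, barr, h, hd]
      exact this.ge
    rcases eq_or_lt_of_le hy.1 with h' | h'
    · have h4 : m ≤ u y := hzmin (by simpa using h'.symm)
      have h5 : barr k y ≤ 1 := by
        unfold barr
        rw [Real.exp_le_one_iff]
        have : 0 ≤ k * ‖y‖ ^ 2 := by positivity
        linarith
      have h6 : 0 < d := Real.exp_pos _
      simp only [hw]
      nlinarith
    exfalso
    have hyU : y ∈ UU N := by
      rw [mem_UU]
      refine ⟨h, ?_⟩
      rintro rfl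
      simp at h'
      linarith
    have hloc : IsLocalMin w y := by
      have hopen : IsOpen {x : E N | 1 / 2 < ‖x‖ ∧ ‖x‖ < 1} :=
        (isOpen_lt continuous_const continuous_norm).inter (isOpen_lt continuous_norm continuous_const)
      filter_upwards [hopen.mem_nhds (show y ∈ {x : E N | 1 / 2 < ‖x‖ ∧ ‖x‖ < 1} from ⟨h', h⟩)] with x hx
      exact hymin (show x ∈ {x : E N | 1 / 2 ≤ ‖x‖ ∧ ‖x‖ ≤ 1} from ⟨hx.1.le, hx.2.le⟩)
    have hnn : 0 ≤ ∑ i, pd (pd w i) i y := Finset.sum_nonneg fun i _ => local_min_pd hwC hyU hloc i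
    rw [hw, lap_sub_barr hu k m d hyU] at hnn
    have hb : 0 < barr k y := Real.exp_pos _
    have hl := hlap y hyU
    have hN0 : (0:ℝ) ≤ N := by positivity
    have hy2 : 1 / 4 ≤ ‖y‖ ^ 2 := by nlinarith
    have h7 : 0 < 4 * k ^ 2 * ‖y‖ ^ 2 - 2 * k * N := by
      have : k ^ 2 ≤ 4 * k ^ 2 * ‖y‖ ^ 2 := by nlinarith [sq_nonneg k]
      have : 2 * k * N < k ^ 2 := by rw [sq, hk]; nlinarith
      linarith
    have h8 := mul_pos hm (mul_pos h7 hb)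
    linarith
  refine ⟨m * (k * d), by positivity, fun x h1 h2 => ?_⟩
  have h := hwpos x h1 h2
  simp only [hw] at h
  have h9 : k * d * (1 - ‖x‖ ^ 2) ≤ barr k x - d := by
    have e : barr k x = d * Real.exp (k * (1 - ‖x‖ ^ 2)) := by
      rw [hd, ← Real.exp_add]
      unfold barr
      congr 1
      ring
    rw [e]
    have := Real.add_one_le_exp (k * (1 - ‖x‖ ^ 2))
    have hd0 : 0 < d := Real.exp_pos _
    nlinarith
  nlinarith

/-! ### Boundary behaviour -/

abbrev SS (N : ℕ) : Set (E N) := closedBall (0 : E N) 1 \ {0}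

lemma SS_unique : UniqueDiffOn ℝ (SS N) := by
  have h1 : UniqueDiffOn ℝ (closedBall (0 : E N) 1) := by
    apply uniqueDiffOn_convex (convex_closedBall _ _)
    rw [interior_closedBall _ (by norm_num)]
    exact ⟨0, by simp⟩
  have := h1.inter (isOpen_compl_singleton (x := (0 : E N)))
  exact this

lemma tangent_nonneg {f : E N → ℝ} {L : E N →L[ℝ] ℝ} {x : E N} (hx : ‖x‖ = 1)
    (hf : HasFDerivWithinAt f L (SS N) x) (hmin : IsLocalMinOn f (SS N) x)
    {y : E N} (hy : inner ℝ x y < 0) : 0 ≤ L y := by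
  apply hmin.hasFDerivWithinAt_nonneg hf
  apply mem_posTangentConeAt_of_frequently_mem
  apply Eventually.frequently
  have hx0 : x ≠ 0 := by rintro rfl; simp at hx
  have hc : Continuous (fun t : ℝ => x + t • y) := by fun_prop
  have e1 : ∀ᶠ t : ℝ in 𝓝 0, x + t • y ≠ 0 := by
    apply hc.continuousAt.eventually_ne
    simpa using hx0
  have e2 : ∀ᶠ t : ℝ in 𝓝 0, 2 * inner ℝ x y + t * ‖y‖ ^ 2 < 0 := by
    have hc2 : Continuous (fun t : ℝ => 2 * inner ℝ x y + t * ‖y‖ ^ 2) := by fun_prop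
    apply hc2.continuousAt.eventually_lt_const
    simp
    linarith
  filter_upwards [nhdsWithin_le_nhds e1, nhdsWithin_le_nhds e2, self_mem_nhdsWithin] with t h1 h2 h3
  refine ⟨?_, h1⟩
  have h3 : 0 < t := h3
  have : ‖x + t • y‖ ^ 2 ≤ 1 := by
    rw [norm_add_sq_real, hx, inner_smul_right, norm_smul, mul_pow, Real.norm_eq_abs, sq_abs]
    nlinarith
  rw [mem_closedBall_zero_iff]
  nlinarith [norm_nonneg (x + t • y)]

lemma bdry_deriv {u : E N → ℝ} (hu : ContDiffOn ℝ 2 u (SS N))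
    {c : ℝ} (hc : ∀ x : E N, 1 / 2 ≤ ‖x‖ → ‖x‖ ≤ 1 → c * (1 - ‖x‖ ^ 2) ≤ u x)
    (hc0 : 0 < c)
    (hbd : ∀ x : E N, ‖x‖ = 1 → u x = 0) {x : E N} (hx : ‖x‖ = 1) :
    fderivWithin ℝ u (SS N) x x < 0 ∧
      ∀ y, fderivWithin ℝ u (SS N) x y = inner ℝ x y * fderivWithin ℝ u (SS N) x x := by
  have hxS : x ∈ SS N := by
    refine ⟨by simp [hx], ?_⟩
    rintro rfl; simp at hx
  have hd := ((hu x hxS).differentiableWithinAt (by norm_num)).hasFDerivWithinAt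
  set L := fderivWithin ℝ u (SS N) x
  have hxx : inner ℝ x x = (1:ℝ) := by rw [real_inner_self_eq_norm_sq, hx]; norm_num
  have hev : ∀ᶠ y in 𝓝[SS N] x, 1 / 2 ≤ ‖y‖ ∧ ‖y‖ ≤ 1 := by
    have h1 : ∀ᶠ y : E N in 𝓝 x, 1 / 2 < ‖y‖ := by
      apply continuous_norm.continuousAt.eventually_const_lt
      show (1:ℝ) / 2 < ‖x‖
      rw [hx]; norm_num
    filter_upwards [nhdsWithin_le_nhds h1, self_mem_nhdsWithin] with y h2 h3
    exact ⟨h2.le, by simpa using h3.1⟩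
  have hmin : IsLocalMinOn u (SS N) x := by
    filter_upwards [hev] with y hy
    rw [hbd x hx]
    refine le_trans ?_ (hc y hy.1 hy.2)
    have := hy.2
    have : ‖y‖ ^ 2 ≤ 1 := by nlinarith [norm_nonneg y]
    nlinarith
  have hd2 : HasFDerivWithinAt (fun y : E N => u y + c * ‖y‖ ^ 2) (L + c • (2 • (innerSL ℝ x))) (SS N) x :=
    hd.add ((hasStrictFDerivAt_norm_sq x).hasFDerivAt.hasFDerivWithinAt.const_mul c)
  have hmin2 : IsLocalMinOn (fun y : E N => u y + c * ‖y‖ ^ 2) (SS N) x := by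
    filter_upwards [hev] with y hy
    rw [hbd x hx, hx]
    have := hc y hy.1 hy.2
    linarith
  have hLx : L x < 0 := by
    have := tangent_nonneg hx hd2 hmin2 (y := -x) (by rw [inner_neg_right, hxx]; norm_num)
    simp [hx] at this
    linarith
  refine ⟨hLx, fun y => ?_⟩
  -- directions orthogonal to x
  have horth : ∀ z : E N, inner ℝ x z = (0:ℝ) → 0 ≤ L z := by
    intro z hz
    by_contra hneg
    rw [not_le] at hneg
    -- z - η x
    set η := L z / (2 * L x) with hη
    have hη0 : 0 < η := div_pos_of_neg_of_neg hneg (by linarith)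
    have := tangent_nonneg hx hd hmin (y := z - η • x)
      (by rw [inner_sub_right, inner_smul_right, hz, hxx]; linarith)
    rw [map_sub, map_smul, smul_eq_mul] at this
    have e : η * L x = L z / 2 := by
      have hne : L x ≠ 0 := hLx.ne
      rw [hη, div_mul_eq_mul_div, div_eq_div_iff (by simpa using hne) (by norm_num)]
      ring
    rw [e] at this
    linarith
  set z := y - inner ℝ x y • x with hz
  have hz0 : inner ℝ x z = (0:ℝ) := by
    rw [hz, inner_sub_right, inner_smul_right, hxx]; ring
  have h1 := horth z hz0
  have h2 := horth (-z) (by rw [inner_neg_right, hz0, neg_zero])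
  rw [map_neg] at h2
  have h3 : L z = 0 := by linarith
  rw [hz, map_sub, map_smul, smul_eq_mul] at h3
  linarith

lemma bdry_pos {u v : E N → ℝ} (hu : ContDiffOn ℝ 2 u (SS N)) (hv : ContDiffOn ℝ 2 v (SS N))
    {c c' : ℝ} (hc : ∀ x : E N, 1 / 2 ≤ ‖x‖ → ‖x‖ ≤ 1 → c * (1 - ‖x‖ ^ 2) ≤ u x)
    (hc0 : 0 < c) (hc' : ∀ x : E N, 1 / 2 ≤ ‖x‖ → ‖x‖ ≤ 1 → c' * (1 - ‖x‖ ^ 2) ≤ v x)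
    (hc0' : 0 < c') (hbu : ∀ x : E N, ‖x‖ = 1 → u x = 0) (hbv : ∀ x : E N, ‖x‖ = 1 → v x = 0)
    (a b : ℝ) :
    ∃ ρ : ℝ, 0 < ρ ∧ ρ < 1 ∧ ∀ x ∈ UU N, ρ < ‖x‖ →
      0 < 2 * (∑ j, x j * pd u j x) * (∑ j, x j * pd v j x)
        - ‖x‖ ^ 2 * (∑ j, pd u j x * pd v j x)
        + a * (v x * ∑ j, x j * pd u j x) + b * (u x * ∑ j, x j * pd v j x) := by
  let P : (E N → ℝ) → Fin N → E N → ℝ := fun w j x => fderivWithin ℝ w (SS N) x (ee j)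
  have hPc : ∀ w : E N → ℝ, ContDiffOn ℝ 2 w (SS N) → ∀ j, ContinuousOn (P w j) (SS N) := by
    intro w hw j
    exact (hw.continuousOn_fderivWithin SS_unique (by norm_num)).clm_apply continuousOn_const
  have hPpd : ∀ w : E N → ℝ, ∀ j, ∀ x ∈ UU N, P w j x = pd w j x := by
    intro w j x hx
    simp only [P, pd]
    rw [fderivWithin_of_mem_nhds]
    refine mem_of_superset (UU_open.mem_nhds hx) ?_
    exact sdiff_subset_sdiff_left ball_subset_closedBall
  let G : E N → ℝ := fun x => 2 * (∑ j, x j * P u j x) * (∑ j, x j * P v j x)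
        - ‖x‖ ^ 2 * (∑ j, P u j x * P v j x)
        + a * (v x * ∑ j, x j * P u j x) + b * (u x * ∑ j, x j * P v j x)
  have hGc : ContinuousOn G (SS N) := by
    have hs : ∀ w : E N → ℝ, ContDiffOn ℝ 2 w (SS N) →
        ContinuousOn (fun x => ∑ j, x j * P w j x) (SS N) := fun w hw =>
      continuousOn_finsetSum _ fun j _ => (coord_cont j).continuousOn.mul (hPc w hw j)
    have hD : ContinuousOn (fun x => ∑ j, P u j x * P v j x) (SS N) :=
      continuousOn_finsetSum _ fun j _ => (hPc u hu j).mul (hPc v hv j)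
    have hn : ContinuousOn (fun x : E N => ‖x‖ ^ 2) (SS N) := by fun_prop
    exact ((((continuousOn_const.mul (hs u hu)).mul (hs v hv)).sub (hn.mul hD)).add
      (continuousOn_const.mul (hv.continuousOn.mul (hs u hu)))).add
      (continuousOn_const.mul (hu.continuousOn.mul (hs v hv)))
  have hGb : ∀ x : E N, ‖x‖ = 1 → 0 < G x := by
    intro x hx
    obtain ⟨u1, u2⟩ := bdry_deriv hu hc hc0 hbu hx
    obtain ⟨v1, v2⟩ := bdry_deriv hv hc' hc0' hbv hx
    have pu : ∀ j, P u j x = x j * fderivWithin ℝ u (SS N) x x := by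
      intro j
      simp only [P]
      rw [u2 (ee j)]
      simp [ee, EuclideanSpace.inner_single_right]
    have pv : ∀ j, P v j x = x j * fderivWithin ℝ v (SS N) x x := by
      intro j
      simp only [P]
      rw [v2 (ee j)]
      simp [ee, EuclideanSpace.inner_single_right]
    simp only [G, pu, pv, hbu x hx, hbv x hx, hx]
    set Lu := fderivWithin ℝ u (SS N) x x
    set Lv := fderivWithin ℝ v (SS N) x x
    have hsq : ∑ j, x j * x j = 1 := by rw [sum_sq, hx]; norm_num
    have s1 : ∀ l : ℝ, ∑ j, x j * (x j * l) = l := by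
      intro l
      simp only [← mul_assoc]
      rw [← Finset.sum_mul, hsq, one_mul]
    have s2 : ∑ j, x j * Lu * (x j * Lv) = Lu * Lv := by
      rw [← s1 (Lu * Lv)]
      exact Finset.sum_congr rfl fun j _ => by ring
    rw [s1, s1, s2]
    nlinarith [mul_pos_of_neg_of_neg u1 v1]
  let A : Set (E N) := {x : E N | 1 / 2 ≤ ‖x‖ ∧ ‖x‖ ≤ 1}
  have hAS : A ⊆ SS N := by
    intro x hx
    refine ⟨by simpa using hx.2, ?_⟩
    rintro rfl
    have := hx.1
    simp at this
    linarith
  have hBc : IsCompact (A ∩ G ⁻¹' Iic 0) :=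
    annulus_compact.of_isClosed_subset
      ((hGc.mono hAS).preimage_isClosed_of_isClosed annulus_compact.isClosed isClosed_Iic)
      inter_subset_left
  have fin : ∀ x ∈ UU N, 0 < G x → 0 < 2 * (∑ j, x j * pd u j x) * (∑ j, x j * pd v j x)
        - ‖x‖ ^ 2 * (∑ j, pd u j x * pd v j x)
        + a * (v x * ∑ j, x j * pd u j x) + b * (u x * ∑ j, x j * pd v j x) := by
    intro x hx h
    simpa only [G, hPpd u _ x hx, hPpd v _ x hx] using h
  rcases (A ∩ G ⁻¹' Iic 0).eq_empty_or_nonempty with he | hne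
  · refine ⟨1 / 2, by norm_num, by norm_num, fun x hx h => fin x hx ?_⟩
    by_contra hneg
    have : x ∈ A ∩ G ⁻¹' Iic 0 := ⟨⟨h.le, (mem_UU.1 hx).1.le⟩, not_lt.1 hneg⟩
    rw [he] at this
    exact this
  · obtain ⟨y, hy, hymax⟩ := hBc.exists_isMaxOn hne continuous_norm.continuousOn
    refine ⟨‖y‖, by linarith [hy.1.1], ?_, fun x hx h => fin x hx ?_⟩
    · refine lt_of_le_of_ne hy.1.2 fun h => ?_
      exact absurd (hGb y h) (not_lt.2 hy.2)
    · by_contra hneg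
      have : x ∈ A ∩ G ⁻¹' Iic 0 :=
        ⟨⟨hy.1.1.trans h.le, (mem_UU.1 hx).1.le⟩, not_lt.1 hneg⟩
      have : ‖x‖ ≤ ‖y‖ := hymax this
      linarith

/-! ### Final argument -/

/-- The radial flux of `PF`. -/
lemma flux_eq (u v A : E N → ℝ) (a b : ℝ) (x : E N) :
    ∑ i, x i * PF u v A a b i x =
      2 * (∑ j, x j * pd u j x) * (∑ j, x j * pd v j x)
        - ‖x‖ ^ 2 * (∑ j, pd u j x * pd v j x)
        + a * (v x * ∑ j, x j * pd u j x) + b * (u x * ∑ j, x j * pd v j x)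
        + ‖x‖ ^ 2 * A x := by
  set Su := ∑ j, x j * pd u j x with hSu
  set Sv := ∑ j, x j * pd v j x with hSv
  set D := ∑ j, pd u j x * pd v j x
  have h : ∀ i, x i * PF u v A a b i x =
      (Su + b * u x) * (x i * pd v i x) + (Sv + a * v x) * (x i * pd u i x)
        + (A x - D) * (x i * x i) := by
    intro i
    simp only [PF, ← hSu, ← hSv]
    ring
  rw [Finset.sum_congr rfl fun i _ => h i, Finset.sum_add_distrib, Finset.sum_add_distrib,
    ← Finset.mul_sum, ← Finset.mul_sum, ← Finset.mul_sum, sum_sq, ← hSu, ← hSv]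
  ring

lemma flux_bound (u v A : E N → ℝ) (a b M : ℝ) {x : E N} (hx : x ≠ 0) (hu : |u x| ≤ M)
    (hv : |v x| ≤ M) :
    |∑ i, x i * PF u v A a b i x| ≤ ‖x‖ ^ 2 * (3 * (‖gradient u x‖ * ‖gradient v x‖) + |A x|
      + (|a| + |b|) * M * (‖gradient u x‖ ^ 2 + ‖gradient v x‖ ^ 2 + 1 / ‖x‖ ^ 2)) := by
  rw [flux_eq, sum_x_pd, sum_x_pd, sum_pd_pd]
  have hn : 0 < ‖x‖ := norm_pos_iff.2 hx
  have hM : 0 ≤ M := (abs_nonneg _).trans hu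
  have h1 := abs_real_inner_le_norm x (gradient u x)
  have h2 := abs_real_inner_le_norm x (gradient v x)
  have h3 := abs_real_inner_le_norm (gradient u x) (gradient v x)
  set Su := inner ℝ x (gradient u x)
  set Sv := inner ℝ x (gradient v x)
  set D := inner ℝ (gradient u x) (gradient v x)
  set gu := ‖gradient u x‖ with hgu
  set gv := ‖gradient v x‖ with hgv
  have hgu0 : 0 ≤ gu := norm_nonneg _
  have hgv0 : 0 ≤ gv := norm_nonneg _
  set n := ‖x‖
  have e : n ^ 2 * (3 * (gu * gv) + |A x| + (|a| + |b|) * M * (gu ^ 2 + gv ^ 2 + 1 / n ^ 2))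
      = 2 * ((n * gu) * (n * gv)) + n ^ 2 * (gu * gv) + n ^ 2 * |A x|
        + (|a| + |b|) * M * ((n * gu) ^ 2 + (n * gv) ^ 2 + 1) := by
    field_simp
    ring
  rw [e]
  have k1 : |2 * Su * Sv| ≤ 2 * ((n * gu) * (n * gv)) := by
    rw [mul_assoc, abs_mul, abs_mul, abs_of_pos (by norm_num : (0:ℝ) < 2)]
    gcongr
  have k2 : |n ^ 2 * D| ≤ n ^ 2 * (gu * gv) := by
    rw [abs_mul, abs_of_nonneg (by positivity : 0 ≤ n ^ 2)]
    gcongr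
  have k3 : |n ^ 2 * A x| = n ^ 2 * |A x| := by
    rw [abs_mul, abs_of_nonneg (by positivity : 0 ≤ n ^ 2)]
  have k4 : |a * (v x * Su)| ≤ |a| * M * ((n * gu) ^ 2 + (n * gv) ^ 2 + 1) := by
    rw [abs_mul, abs_mul, mul_assoc]
    have : |Su| ≤ (n * gu) ^ 2 + (n * gv) ^ 2 + 1 := by
      nlinarith [sq_nonneg (n * gu - 1), sq_nonneg (n * gv), sq_nonneg (n * gu)]
    gcongr
  have k5 : |b * (u x * Sv)| ≤ |b| * M * ((n * gu) ^ 2 + (n * gv) ^ 2 + 1) := by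
    rw [abs_mul, abs_mul, mul_assoc]
    have : |Sv| ≤ (n * gu) ^ 2 + (n * gv) ^ 2 + 1 := by
      nlinarith [sq_nonneg (n * gv - 1), sq_nonneg (n * gv), sq_nonneg (n * gu)]
    gcongr
  have t1 := abs_add_le (2 * Su * Sv - n ^ 2 * D + a * (v x * Su) + b * (u x * Sv)) (n ^ 2 * A x)
  have t2 := abs_add_le (2 * Su * Sv - n ^ 2 * D + a * (v x * Su)) (b * (u x * Sv))
  have t3 := abs_add_le (2 * Su * Sv - n ^ 2 * D) (a * (v x * Su))
  have t4 := abs_sub (2 * Su * Sv) (n ^ 2 * D)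
  rw [k3] at t1
  linarith

def AA (α β p q : ℝ) (u v : E N → ℝ) (x : E N) : ℝ :=
  1 / (p + 1) * pot α p u x + 1 / (q + 1) * pot β q v x

lemma AA_C1 {α β p q : ℝ} {u v : E N → ℝ} (hu : ContDiffOn ℝ 2 u (UU N))
    (hv : ContDiffOn ℝ 2 v (UU N)) (hup : ∀ x ∈ UU N, 0 < u x) (hvp : ∀ x ∈ UU N, 0 < v x) :
    ContDiffOn ℝ 1 (AA α β p q u v) (UU N) :=
  (contDiffOn_const.mul (pot_C1 hu hup)).add (contDiffOn_const.mul (pot_C1 hv hvp))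

lemma AA_euler {α β p q : ℝ} (hp : 1 < p) (hq : 1 < q) {u v : E N → ℝ}
    (hu : ContDiffOn ℝ 2 u (UU N))
    (hv : ContDiffOn ℝ 2 v (UU N)) (hup : ∀ x ∈ UU N, 0 < u x) (hvp : ∀ x ∈ UU N, 0 < v x)
    {x : E N} (hx : x ∈ UU N) :
    ∑ i, x i * pd (AA α β p q u v) i x =
      α / (p + 1) * pot α p u x + (‖x‖ ^ α * u x ^ p) * ∑ i, x i * pd u i x
      + (β / (q + 1) * pot β q v x + (‖x‖ ^ β * v x ^ q) * ∑ i, x i * pd v i x) := by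
  have h : ∀ i, pd (AA α β p q u v) i x
      = 1 / (p + 1) * pd (pot α p u) i x + 1 / (q + 1) * pd (pot β q v) i x := by
    intro i
    apply pd_eq (diff_at (AA_C1 hu hv hup hvp) hx)
    exact ((line_pd (diff_at (pot_C1 hu hup) hx) i).const_mul _).fun_add
      ((line_pd (diff_at (pot_C1 hv hvp) hx) i).const_mul _)
  have h' : ∀ i, x i * pd (AA α β p q u v) i x
      = 1 / (p + 1) * (x i * pd (pot α p u) i x) + 1 / (q + 1) * (x i * pd (pot β q v) i x) := by
    intro i
    rw [h i]
    ring
  rw [Finset.sum_congr rfl fun i _ => h' i, Finset.sum_add_distrib, ← Finset.mul_sum,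
    ← Finset.mul_sum, pot_euler hu hup hx, pot_euler hv hvp hx]
  have hp1 : p + 1 ≠ 0 := by linarith
  have hq1 : q + 1 ≠ 0 := by linarith
  field_simp

lemma pot_nonneg {α p : ℝ} {u : E N → ℝ} (hup : ∀ x ∈ UU N, 0 < u x) {x : E N} (hx : x ∈ UU N) :
    0 ≤ pot α p u x :=
  mul_nonneg (Real.rpow_nonneg (norm_nonneg _) _) (Real.rpow_nonneg (hup x hx).le _)

lemma div_nonpos' {α β p q : ℝ} (hp : 1 < p) (hq : 1 < q)
    (hcrit : ((N : ℝ) + α) / (p + 1) + ((N : ℝ) + β) / (q + 1) ≤ (N : ℝ) - 2) {u v : E N → ℝ}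
    (hu : ContDiffOn ℝ 2 u (UU N))
    (hv : ContDiffOn ℝ 2 v (UU N)) (hup : ∀ x ∈ UU N, 0 < u x) (hvp : ∀ x ∈ UU N, 0 < v x)
    (heq1 : ∀ x ∈ UU N, -lap v x = ‖x‖ ^ α * u x ^ p)
    (heq2 : ∀ x ∈ UU N, -lap u x = ‖x‖ ^ β * v x ^ q) {x : E N} (hx : x ∈ UU N) :
    ∑ i, pd (PF u v (AA α β p q u v) ((N : ℝ) - 2 - (N + α) / (p + 1)) ((N + α) / (p + 1)) i) i x
      ≤ 0 := by
  rw [PF_div _ _ hu hv (AA_C1 hu hv hup hvp) hx, AA_euler hp hq hu hv hup hvp hx]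
  have l1 : lap v x = -(‖x‖ ^ α * u x ^ p) := by rw [← heq1 x hx]; ring
  have l2 : lap u x = -(‖x‖ ^ β * v x ^ q) := by rw [← heq2 x hx]; ring
  have p1 : u x * (‖x‖ ^ α * u x ^ p) = pot α p u x := by
    rw [pot, Real.rpow_add_one (hup x hx).ne']; ring
  have p2 : v x * (‖x‖ ^ β * v x ^ q) = pot β q v x := by
    rw [pot, Real.rpow_add_one (hvp x hx).ne']; ring
  have n1 : 0 ≤ pot β q v x := pot_nonneg hvp hx
  rw [l1, l2, mul_neg (v x), mul_neg (u x), p1, p2]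
  set PU := pot α p u x
  set PV := pot β q v x
  unfold AA
  have key : ((N + β) / (q + 1) - ((N : ℝ) - 2 - (N + α) / (p + 1))) * PV ≤ 0 :=
    mul_nonpos_of_nonpos_of_nonneg (by linarith) n1
  refine le_of_eq_of_le ?_ key
  ring

theorem main (hN : 3 ≤ N) (α β p q : ℝ) (hp : 1 < p) (hq : 1 < q)
    (hcrit : ((N : ℝ) + α) / (p + 1) + ((N : ℝ) + β) / (q + 1) ≤ (N : ℝ) - 2)
    (u v : E N → ℝ)
    (huc : ContinuousOn u (closedBall 0 1)) (hvc : ContinuousOn v (closedBall 0 1))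
    (hu2 : ContDiffOn ℝ 2 u (SS N))
    (hv2 : ContDiffOn ℝ 2 v (SS N))
    (hup : ∀ x ∈ UU N, 0 < u x)
    (hvp : ∀ x ∈ UU N, 0 < v x)
    (hbd : ∀ x : E N, ‖x‖ = 1 → u x = 0 ∧ v x = 0)
    (heq1 : ∀ x ∈ UU N, -lap v x = ‖x‖ ^ α * u x ^ p)
    (heq2 : ∀ x ∈ UU N, -lap u x = ‖x‖ ^ β * v x ^ q)
    (hint1 : IntegrableOn (pot α p u) (ball 0 1))
    (hint2 : IntegrableOn (pot β q v) (ball 0 1))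
    (hint3 : IntegrableOn (fun x : E N => ‖gradient u x‖ * ‖gradient v x‖) (ball 0 1)) :
    False := by
  have : Nonempty (Fin N) := ⟨⟨0, by omega⟩⟩
  have : Nontrivial (E N) := inferInstance
  have hUS : UU N ⊆ SS N := sdiff_subset_sdiff_left ball_subset_closedBall
  have hu := hu2.mono hUS
  have hv := hv2.mono hUS
  have lu : ∀ x ∈ UU N, lap u x ≤ 0 := by
    intro x hx
    have h1 := heq2 x hx
    have h2 : 0 ≤ ‖x‖ ^ β * v x ^ q :=
      mul_nonneg (Real.rpow_nonneg (norm_nonneg _) _) (Real.rpow_nonneg (hvp x hx).le _)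
    linarith
  have lv : ∀ x ∈ UU N, lap v x ≤ 0 := by
    intro x hx
    have h1 := heq1 x hx
    have h2 : 0 ≤ ‖x‖ ^ α * u x ^ p :=
      mul_nonneg (Real.rpow_nonneg (norm_nonneg _) _) (Real.rpow_nonneg (hup x hx).le _)
    linarith
  obtain ⟨M1, hM1⟩ := (isCompact_closedBall (0 : E N) 1).exists_bound_of_continuousOn huc
  obtain ⟨M2, hM2⟩ := (isCompact_closedBall (0 : E N) 1).exists_bound_of_continuousOn hvc
  set M := max M1 M2
  have hMu : ∀ x ∈ UU N, |u x| ≤ M := fun x hx =>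
    (hM1 x (ball_subset_closedBall hx.1)).trans (le_max_left _ _)
  have hMv : ∀ x ∈ UU N, |v x| ≤ M := fun x hx =>
    (hM2 x (ball_subset_closedBall hx.1)).trans (le_max_right _ _)
  obtain ⟨c, hc0, hc⟩ := hopf hN huc hu hup (fun x hx => (hbd x hx).1) lu
  obtain ⟨c', hc0', hc'⟩ := hopf hN hvc hv hvp (fun x hx => (hbd x hx).2) lv
  set b : ℝ := (N + α) / (p + 1) with hb
  set a : ℝ := (N : ℝ) - 2 - b with ha
  obtain ⟨ρ, hρ0, hρ1, hρ⟩ := bdry_pos hu2 hv2 hc hc0 hc' hc0' (fun x hx => (hbd x hx).1)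
    (fun x hx => (hbd x hx).2) a b
  set δ : ℝ := (1 - ρ ^ 2) / 4 with hδ
  have hρsq : ρ ^ 2 < 1 := by nlinarith
  have hδ0 : 0 < δ := by rw [hδ]; linarith
  have hδ1 : δ < 1 / 2 := by rw [hδ]; nlinarith [sq_nonneg ρ]
  have hδρ : ρ ^ 2 ≤ 1 - 2 * δ := by rw [hδ]; linarith
  set A := AA α β p q u v with hA
  have hAC : ContDiffOn ℝ 1 A (UU N) := AA_C1 hu hv hup hvp
  have hFC : ∀ i, ContDiffOn ℝ 1 (PF u v A a b i) (UU N) := PF_C1 a b hu hv hAC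
  set G : E N → ℝ := fun x => 2 * ∑ i, x i * PF u v A a b i x with hG
  have hGc : ContinuousOn G (UU N) :=
    continuousOn_const.mul (continuousOn_finsetSum _ fun i _ =>
      (coord_cont i).continuousOn.mul (hFC i).continuousOn)
  have hAnn : ∀ x ∈ UU N, 0 ≤ A x := by
    intro x hx
    have h1 : 0 ≤ pot α p u x := pot_nonneg hup hx
    have h2 : 0 ≤ pot β q v x := pot_nonneg hvp hx
    have hp1 : 0 < p + 1 := by linarith
    have hq1 : 0 < q + 1 := by linarith
    simp only [hA, AA]
    positivity
  have hGpos : ∀ x : E N, 1 - 2 * δ < ‖x‖ ^ 2 → ‖x‖ ^ 2 < 1 - δ → 0 < G x := by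
    intro x h1 h2
    have hx : x ∈ UU N := mem_UU_of_sq (r := 1 - 2 * δ) (R := 1 - δ) (by linarith) (by linarith)
      ⟨h1.le, h2.le⟩
    have h3 : ρ < ‖x‖ := by
      apply lt_of_pow_lt_pow_left₀ 2 (norm_nonneg _)
      linarith
    have h4 := hρ x hx h3
    have h5 : 0 ≤ ‖x‖ ^ 2 * A x := mul_nonneg (by positivity) (hAnn x hx)
    simp only [hG, flux_eq]
    linarith
  -- the approximations have nonnegative integral
  have hge : ∀ ε : ℝ, 0 < ε → 0 ≤ ∫ x : E N, gd δ ε (‖x‖ ^ 2) * G x := by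
    intro ε hε
    obtain ⟨i1, i2⟩ := radial_int hFC (gc_cont δ ε) (gd_cont δ ε) hε (by linarith : 1 - δ < 1)
      (gc_supp hδ0 hε) (gd_supp hδ0 hε)
    have h0 := radial_test hFC (gc_hasDerivAt δ ε) (gd_cont δ ε) hε (by linarith : 1 - δ < 1)
      (gc_supp hδ0 hε) (gd_supp hδ0 hε)
    rw [integral_add i1 i2] at h0
    have h1 : ∫ x : E N, gc δ ε (‖x‖ ^ 2) * ∑ i, pd (PF u v A a b i) i x ≤ 0 := by
      apply integral_nonpos
      intro x
      show gc δ ε (‖x‖ ^ 2) * ∑ i, pd (PF u v A a b i) i x ≤ 0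
      by_cases hx : ‖x‖ ^ 2 ∈ Icc ε (1 - δ)
      · exact mul_nonpos_of_nonneg_of_nonpos (gc_nonneg _ _ _)
          (div_nonpos' hp hq hcrit hu hv hup hvp heq1 heq2 (mem_UU_of_sq hε (by linarith) hx))
      · rw [gc_supp hδ0 hε _ hx, zero_mul]
    linarith
  -- limit
  set k : ℝ → ℝ := fun s => -(tb ((1 - δ - s) / δ) / δ) * tT 1 with hk
  have hkc : Continuous k := by
    have := tb_cont
    simp only [hk]
    fun_prop
  have hks : ∀ s, s ∉ Icc (1 - 2 * δ) (1 - δ) → k s = 0 := by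
    intro s hs
    simp only [hk]
    by_cases h : s < 1 - 2 * δ
    · rw [tb_zero_right (by rw [le_div_iff₀ hδ0]; linarith)]; simp
    · have : 1 - δ < s := by
        by_contra h'
        exact hs ⟨not_lt.1 h, not_lt.1 h'⟩
      rw [tb_zero_left (div_nonpos_of_nonpos_of_nonneg (by linarith) hδ0.le)]; simp
  have hki : Integrable (fun x : E N => k (‖x‖ ^ 2) * G x) :=
    integrable_rad hkc (by linarith) (by linarith) hks hGc
  set K : Set (E N) := {x : E N | ‖x‖ ^ 2 ≤ 1 - 2 * (δ / 2)} with hK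
  have hKm : MeasurableSet K := (isClosed_le (by fun_prop) continuous_const).measurableSet
  have hKb : K ⊆ ball 0 1 := by
    intro x hx
    have : ‖x‖ ^ 2 ≤ 1 - 2 * (δ / 2) := hx
    rw [mem_ball_zero_iff]
    nlinarith [norm_nonneg x]
  set H : E N → ℝ := fun x => 3 * (‖gradient u x‖ * ‖gradient v x‖) + |A x|
      + (|a| + |b|) * M * (‖gradient u x‖ ^ 2 + ‖gradient v x‖ ^ 2 + 1 / ‖x‖ ^ 2) with hH
  have hHi : IntegrableOn H K := by
    have e1 := energy hN hu hMu lu (δ := δ / 2) (by linarith) (by linarith)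
    have e2 := energy hN hv hMv lv (δ := δ / 2) (by linarith) (by linarith)
    have e3 := (integrable_inv_sq hN).mono_set hKb
    have e4 : IntegrableOn A (ball 0 1) := (hint1.const_mul _).add (hint2.const_mul _)
    have e5 := e4.mono_set hKb
    have e6 := hint3.mono_set hKb
    exact ((e6.const_mul 3).add e5.abs).add (((e1.add e2).add e3).const_mul _)
  set bd : E N → ℝ := K.indicator (fun x => (1 / δ + 2) * 2 * H x) with hbd'
  have hbdi : Integrable bd := (integrable_indicator_iff hKm).2 (hHi.const_mul _)
  have hae : ∀ᵐ x : E N, x ≠ 0 := by simp [ae_iff]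
  have hlim : Tendsto (fun n : ℕ => ∫ x : E N, gd δ (1 / ((n : ℝ) + 1)) (‖x‖ ^ 2) * G x) atTop
      (𝓝 (∫ x : E N, k (‖x‖ ^ 2) * G x)) := by
    apply tendsto_integral_of_dominated_convergence bd
    · intro n
      exact (integrable_rad (gd_cont δ _) (by positivity) (by linarith : 1 - δ < 1)
        (gd_supp hδ0 (by positivity)) hGc).aestronglyMeasurable
    · exact hbdi
    · intro n
      filter_upwards [hae] with x hx
      have hε : 0 < 1 / ((n : ℝ) + 1) := by positivity
      by_cases hm : ‖x‖ ^ 2 ∈ Icc (1 / ((n : ℝ) + 1)) (1 - δ)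
      · have hxU : x ∈ UU N := mem_UU_of_sq hε (by linarith) hm
        have hxK : x ∈ K := by
          show ‖x‖ ^ 2 ≤ 1 - 2 * (δ / 2)
          linarith [hm.2]
        rw [hbd', indicator_of_mem hxK, Real.norm_eq_abs, abs_mul]
        have hn : 0 < ‖x‖ ^ 2 := by positivity
        have g1 := gd_bound hδ0 hε hn
        have g2 : |G x| ≤ 2 * (‖x‖ ^ 2 * H x) := by
          simp only [hG]
          rw [abs_mul, abs_of_pos (by norm_num : (0:ℝ) < 2)]
          exact mul_le_mul_of_nonneg_left (flux_bound u v A a b M hx (hMu x hxU) (hMv x hxU))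
            (by norm_num)
        calc _ ≤ (1 / δ + 2) / ‖x‖ ^ 2 * (2 * (‖x‖ ^ 2 * H x)) :=
              mul_le_mul g1 g2 (abs_nonneg _) (by positivity)
          _ = (1 / δ + 2) * 2 * H x := by field_simp
      · rw [gd_supp hδ0 hε _ hm, zero_mul, norm_zero]
        apply indicator_nonneg
        intro y hy
        have hM0 : 0 ≤ M := by
          have := hM1 0 (by simp)
          exact (norm_nonneg _).trans (this.trans (le_max_left _ _))
        simp only [hH]
        positivity
    · filter_upwards [hae] with x hx
      have hn : 0 < ‖x‖ ^ 2 := by positivity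
      apply tendsto_const_nhds.congr'
      have h0 : Tendsto (fun n : ℕ => 2 * (1 / ((n : ℝ) + 1))) atTop (𝓝 (2 * 0)) :=
        tendsto_one_div_add_atTop_nhds_zero_nat.const_mul 2
      rw [mul_zero] at h0
      filter_upwards [h0.eventually_le_const hn] with n hn'
      rw [gd_limit δ (by positivity) hn']
  have hfin : 0 ≤ ∫ x : E N, k (‖x‖ ^ 2) * G x :=
    ge_of_tendsto' hlim fun n => hge _ (by positivity)
  -- strict negativity
  have htT := tT_one_pos
  have hneg : ∀ x : E N, 1 - 2 * δ < ‖x‖ ^ 2 → ‖x‖ ^ 2 < 1 - δ → 0 < -(k (‖x‖ ^ 2) * G x) := by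
    intro x h1 h2
    have h3 : 0 < tb ((1 - δ - ‖x‖ ^ 2) / δ) :=
      tb_pos (div_pos (by linarith) hδ0) (by rw [div_lt_one hδ0]; linarith)
    have h4 := hGpos x h1 h2
    have h5 : 0 < tb ((1 - δ - ‖x‖ ^ 2) / δ) / δ * tT 1 * G x := by positivity
    simp only [hk]
    linarith
  have hnn : ∀ x : E N, 0 ≤ -(k (‖x‖ ^ 2) * G x) := by
    intro x
    by_cases h : 1 - 2 * δ < ‖x‖ ^ 2 ∧ ‖x‖ ^ 2 < 1 - δ
    · exact (hneg x h.1 h.2).le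
    · have : k (‖x‖ ^ 2) = 0 := by
        simp only [hk]
        by_cases h1 : 1 - 2 * δ < ‖x‖ ^ 2
        · have h2 : 1 - δ ≤ ‖x‖ ^ 2 := not_lt.1 fun h2 => h ⟨h1, h2⟩
          rw [tb_zero_left (div_nonpos_of_nonpos_of_nonneg (by linarith) hδ0.le)]; simp
        · rw [tb_zero_right (by rw [le_div_iff₀ hδ0]; linarith)]; simp
      rw [this]; simp
  have hpos : 0 < ∫ x : E N, -(k (‖x‖ ^ 2) * G x) := by
    rw [integral_pos_iff_support_of_nonneg hnn hki.neg]
    set O : Set (E N) := {x | 1 - 2 * δ < ‖x‖ ^ 2 ∧ ‖x‖ ^ 2 < 1 - δ} with hO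
    have hnc : Continuous (fun x : E N => ‖x‖ ^ 2) := by fun_prop
    have hOo : IsOpen O :=
      (isOpen_lt continuous_const hnc).inter (isOpen_lt hnc continuous_const)
    have hOn : O.Nonempty := by
      obtain ⟨x, hx⟩ := (NormedSpace.sphere_nonempty (x := (0 : E N)) (r := √(1 - 3 / 2 * δ))).2
        (Real.sqrt_nonneg _)
      have hx' : ‖x‖ = √(1 - 3 / 2 * δ) := by simpa using hx
      have hx2 : ‖x‖ ^ 2 = 1 - 3 / 2 * δ := by rw [hx', Real.sq_sqrt (by linarith)]
      refine ⟨x, ?_, ?_⟩ <;> rw [hx2] <;> linarith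
    refine lt_of_lt_of_le (hOo.measure_pos volume hOn) (measure_mono ?_)
    intro x hx
    exact (hneg x hx.1 hx.2).ne'
  rw [integral_neg] at hpos
  linarith

end CR

/-- Calanchi–Ruf non-existence (generalized Pohozaev identity): on or above the critical
hyperbola (N+α)/(p+1) + (N+β)/(q+1) = N-2 the Hardy–Hénon system has no positive
strong solution on the unit ball. -/
theorem stmt10 {N : ℕ} (hN : 3 ≤ N) (α β p q : ℝ)
    (hα : -(N : ℝ) < α) (hβ : -(N : ℝ) < β) (hp : 1 < p) (hq : 1 < q)
    (hcrit : ((N : ℝ) + α) / (p + 1) + ((N : ℝ) + β) / (q + 1) ≤ (N : ℝ) - 2)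
    (u v : E N → ℝ)
    (huc : ContinuousOn u (closedBall 0 1)) (hvc : ContinuousOn v (closedBall 0 1))
    (hu2 : ContDiffOn ℝ 2 u (closedBall (0 : E N) 1 \ {0}))
    (hv2 : ContDiffOn ℝ 2 v (closedBall (0 : E N) 1 \ {0}))
    (hupos : ∀ x ∈ ball (0 : E N) 1 \ {0}, 0 < u x)
    (hvpos : ∀ x ∈ ball (0 : E N) 1 \ {0}, 0 < v x)
    (hbd : ∀ x : E N, ‖x‖ = 1 → u x = 0 ∧ v x = 0)
    (heq1 : ∀ x ∈ ball (0 : E N) 1 \ {0}, -lap v x = ‖x‖ ^ α * u x ^ p)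
    (heq2 : ∀ x ∈ ball (0 : E N) 1 \ {0}, -lap u x = ‖x‖ ^ β * v x ^ q)
    (hint1 : IntegrableOn (fun x : E N => ‖x‖ ^ α * u x ^ (p + 1)) (ball 0 1))
    (hint2 : IntegrableOn (fun x : E N => ‖x‖ ^ β * v x ^ (q + 1)) (ball 0 1))
    (hint3 : IntegrableOn (fun x : E N => ‖gradient u x‖ * ‖gradient v x‖) (ball 0 1)) :
    False := by
  exact CR.main hN α β p q hp hq hcrit u v huc hvc hu2 hv2 hupos hvpos hbd heq1 heq2 hint1 hint2 hint3
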